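/- arXiv:2407.06353 — 3 statements merged into one kernel-verified Lean document; each statement's English description precedes it below -/
import Mathlib

section
/- Let S and R be associative rings with identity and let T be an (S,R)-bimodule that is Wakamatsu tilting (i.e., a semidualizing (S,R)-bimodule). If the projective dimension of T as a right R-module is finite and T is tensorly faithful, then T is projective as a right R-module. -/
/-!
Common definitions for formalizing the Wakamatsu tilting conjecture paper.
All rings are associative with identity; right `R`-modules are treated as
left `Rᵐᵒᵖ`-modules.
-/

open CategoryTheory

universe u

/-- Vanishing of `Ext^n_S(X, Y)` for left `S`-modules. -/
abbrev ExtVanish (S : Type u) [Ring S] (n : ℕ) (X Y : ModuleCat.{u} S) : Prop :=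
  Subsingleton (((Ext ℤ (ModuleCat.{u} S) n).obj (Opposite.op X)).obj Y)

/-- `N ∈ add_S T`: `N` is a direct summand of a finite direct sum of copies of `T`. -/
def MemAdd (S : Type u) [Ring S] (T N : ModuleCat.{u} S) : Prop :=
  ∃ (k : ℕ) (M : ModuleCat.{u} S), Nonempty ((↥N × ↥M) ≃ₗ[S] (Fin k → ↥T))

/-- `N ∈ gen*_S(T)`: there is an exact sequence `⋯ → X_1 → X_0 → N → 0` with all
`X_i ∈ add_S T` and `Ext^1_S(T, Ker f_i) = 0` for all `i ≥ 0`. -/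
def MemGenStar (S : Type u) [Ring S] (T N : ModuleCat.{u} S) : Prop :=
  ∃ (X : ℕ → ModuleCat.{u} S) (f : ∀ i, ↥(X (i + 1)) →ₗ[S] ↥(X i)) (f0 : ↥(X 0) →ₗ[S] ↥N),
    (∀ i, MemAdd S T (X i)) ∧
    Function.Surjective f0 ∧
    Function.Exact (f 0) f0 ∧
    (∀ i, Function.Exact (f (i + 1)) (f i)) ∧
    ExtVanish S 1 T (ModuleCat.of S (LinearMap.ker f0)) ∧
    (∀ i, ExtVanish S 1 T (ModuleCat.of S (LinearMap.ker (f i))))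

/-- The projective dimension of the left `S`-module `M` is at most `n`: there is a projective
resolution `0 → P_n → ⋯ → P_0 → M → 0`. -/
def PdLE (S : Type u) [Ring S] (M : ModuleCat.{u} S) (n : ℕ) : Prop :=
  ∃ (P : ℕ → ModuleCat.{u} S) (d : ∀ i, ↥(P (i + 1)) →ₗ[S] ↥(P i)) (ε : ↥(P 0) →ₗ[S] ↥M),
    (∀ i, Module.Projective S ↥(P i)) ∧
    Function.Surjective ε ∧
    Function.Exact (d 0) ε ∧
    (∀ i, Function.Exact (d (i + 1)) (d i)) ∧
    (∀ i, n < i → Subsingleton ↥(P i))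

/-- The projective dimension of `M` equals `n`. -/
def PdEq (S : Type u) [Ring S] (M : ModuleCat.{u} S) (n : ℕ) : Prop :=
  PdLE S M n ∧ ∀ m, PdLE S M m → n ≤ m

/-- `N ∈ T^⊥`: `Ext^i_S(T, N) = 0` for all `i ≥ 1`. -/
def MemPerp (S : Type u) [Ring S] (T N : ModuleCat.{u} S) : Prop :=
  ∀ i, 1 ≤ i → ExtVanish S i T N

/-- `N ∈ X_T = T^⊥ ∩ gen*_S(T)`. -/
def MemXT (S : Type u) [Ring S] (T N : ModuleCat.{u} S) : Prop :=
  MemPerp S T N ∧ MemGenStar S T N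

/-- There is an exact sequence `0 → B → X_0 → ⋯ → X_n → 0` with all `X_i ∈ add_S T`. -/
def HasFiniteAddCoresolution (S : Type u) [Ring S] (T B : ModuleCat.{u} S) (n : ℕ) : Prop :=
  ∃ (X : ℕ → ModuleCat.{u} S) (g : ∀ i, ↥(X i) →ₗ[S] ↥(X (i + 1))) (g0 : ↥B →ₗ[S] ↥(X 0)),
    (∀ i, i ≤ n → MemAdd S T (X i)) ∧
    (∀ i, n < i → Subsingleton ↥(X i)) ∧
    Function.Injective g0 ∧
    Function.Exact g0 (g 0) ∧
    (∀ i, Function.Exact (g i) (g (i + 1)))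

/-- `T` is an `n`-tilting left `A`-module (Miyashita); applying this with `A = Rᵐᵒᵖ`
gives the notion for right `R`-modules. -/
def IsNTilting (A : Type u) [Ring A] (T : ModuleCat.{u} A) (n : ℕ) : Prop :=
  MemGenStar A (ModuleCat.of A A) T ∧
  PdLE A T n ∧
  (∀ i, 0 < i → ExtVanish A i T T) ∧
  HasFiniteAddCoresolution A T (ModuleCat.of A A) n

/-- `T` is a Wakamatsu tilting left `A`-module (Definition 2.2); applying this with
`A = Rᵐᵒᵖ` gives the notion for right `R`-modules: `T ∈ gen*(A)`, `Ext^i_A(T,T) = 0` for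
`i > 0`, and there is an exact sequence `0 → A → X_0 → X_1 → ⋯` with `X_i ∈ add T`
which stays exact after applying `Hom_A(-, T)`. -/
def IsWakamatsuTilting (A : Type u) [Ring A] (T : ModuleCat.{u} A) : Prop :=
  MemGenStar A (ModuleCat.of A A) T ∧
  (∀ i, 0 < i → ExtVanish A i T T) ∧
  ∃ (X : ℕ → ModuleCat.{u} A) (g : ∀ i, ↥(X i) →ₗ[A] ↥(X (i + 1))) (g0 : A →ₗ[A] ↥(X 0)),
    (∀ i, MemAdd A T (X i)) ∧
    Function.Injective g0 ∧
    Function.Exact g0 (g 0) ∧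
    (∀ i, Function.Exact (g i) (g (i + 1))) ∧
    Function.Surjective (fun h : ↥(X 0) →ₗ[A] ↥T => h.comp g0) ∧
    Function.Exact (fun h : ↥(X 1) →ₗ[A] ↥T => h.comp (g 0))
      (fun h : ↥(X 0) →ₗ[A] ↥T => h.comp g0) ∧
    (∀ i, Function.Exact (fun h : ↥(X (i + 2)) →ₗ[A] ↥T => h.comp (g (i + 1)))
      (fun h : ↥(X (i + 1)) →ₗ[A] ↥T => h.comp (g i)))

/-- The subgroup of `T ⊗_ℤ M` generated by the balancing relations `(t·r) ⊗ m - t ⊗ (r·m)`;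
the quotient of `T ⊗_ℤ M` by it is the balanced tensor product `T ⊗_R M`. -/
noncomputable def TensorRel (R : Type u) [Ring R] (T : Type u) [AddCommGroup T]
    [Module Rᵐᵒᵖ T] (M : Type u) [AddCommGroup M] [Module R M] :
    AddSubgroup (TensorProduct ℤ T M) :=
  AddSubgroup.closure
    {x | ∃ (t : T) (r : R) (m : M),
      x = (MulOpposite.op r • t) ⊗ₜ[ℤ] m - t ⊗ₜ[ℤ] (r • m)}

/-- The right `R`-module `T` is tensorly faithful: `T ⊗_R M ≠ 0` for every nonzero left
`R`-module `M` (equivalently, the balancing relations do not exhaust `T ⊗_ℤ M`). -/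
def TensorlyFaithful (R : Type u) [Ring R] (T : Type u) [AddCommGroup T]
    [Module Rᵐᵒᵖ T] : Prop :=
  ∀ (M : Type u) [AddCommGroup M] [Module R M], Nontrivial M → TensorRel R T M ≠ ⊤

/-- The natural ring homomorphism `Rᵐᵒᵖ →+* End(_S T)` induced by the right `R`-action;
it being bijective says exactly that `R → End(_S T)ᵒᵖ` is an isomorphism. -/
def rightEndNat (S R : Type u) [Ring S] [Ring R] (T : Type u) [AddCommGroup T] [Module S T]
    [Module Rᵐᵒᵖ T] [SMulCommClass S Rᵐᵒᵖ T] : Rᵐᵒᵖ →+* Module.End S T :=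
  haveI := SMulCommClass.symm S Rᵐᵒᵖ T
  Module.toModuleEnd S T

/-- The bimodule `T` is Wakamatsu tilting, i.e. a semidualizing `(S,R)`-bimodule
(Lemma 2.3(iii)). -/
def IsSemidualizing (S R : Type u) [Ring S] [Ring R] (T : Type u) [AddCommGroup T]
    [Module S T] [Module Rᵐᵒᵖ T] [SMulCommClass S Rᵐᵒᵖ T] : Prop :=
  MemGenStar Rᵐᵒᵖ (ModuleCat.of Rᵐᵒᵖ Rᵐᵒᵖ) (ModuleCat.of Rᵐᵒᵖ T) ∧
  MemGenStar S (ModuleCat.of S S) (ModuleCat.of S T) ∧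
  Function.Bijective (Module.toModuleEnd Rᵐᵒᵖ T : S →+* Module.End Rᵐᵒᵖ T) ∧
  Function.Bijective (rightEndNat S R T) ∧
  (∀ i, 0 < i → ExtVanish Rᵐᵒᵖ i (ModuleCat.of Rᵐᵒᵖ T) (ModuleCat.of Rᵐᵒᵖ T)) ∧
  (∀ i, 0 < i → ExtVanish S i (ModuleCat.of S T) (ModuleCat.of S T))

/-- The left `R`-module structure on `Hom_S(T, M)` given by `(r • f) t = f (t · r)`. -/
def homModule (S R : Type u) [Ring S] [Ring R] (T : Type u) [AddCommGroup T] [Module S T]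
    [Module Rᵐᵒᵖ T] [SMulCommClass S Rᵐᵒᵖ T] (M : Type u) [AddCommGroup M] [Module S M] :
    Module R (T →ₗ[S] M) where
  smul r f :=
    { toFun := fun t => f (MulOpposite.op r • t)
      map_add' := fun t₁ t₂ => by
        show f (MulOpposite.op r • (t₁ + t₂)) = _
        rw [smul_add, map_add]
      map_smul' := fun s t => by
        show f (MulOpposite.op r • (s • t)) = s • f (MulOpposite.op r • t)
        rw [← smul_comm s (MulOpposite.op r) t, map_smul] }
  one_smul f := by
    apply LinearMap.ext; intro t
    show f ((MulOpposite.op (1 : R)) • t) = f t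
    rw [MulOpposite.op_one, one_smul]
  mul_smul r₁ r₂ f := by
    apply LinearMap.ext; intro t
    show f ((MulOpposite.op (r₁ * r₂)) • t) = f (MulOpposite.op r₂ • MulOpposite.op r₁ • t)
    rw [MulOpposite.op_mul, mul_smul]
  smul_zero r := by apply LinearMap.ext; intro t; rfl
  smul_add r f g := by apply LinearMap.ext; intro t; rfl
  add_smul r₁ r₂ f := by
    apply LinearMap.ext; intro t
    show f ((MulOpposite.op (r₁ + r₂)) • t) = f (MulOpposite.op r₁ • t) + f (MulOpposite.op r₂ • t)
    rw [MulOpposite.op_add, add_smul, map_add]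
  zero_smul f := by
    apply LinearMap.ext; intro t
    show f ((MulOpposite.op (0 : R)) • t) = 0
    rw [MulOpposite.op_zero, zero_smul, map_zero]

/-- The evaluation map `T ⊗_ℤ Hom_S(T, M) → M`, `t ⊗ h ↦ h t`. -/
noncomputable def evalMap (S : Type u) [Ring S] (T : Type u) [AddCommGroup T] [Module S T]
    (M : Type u) [AddCommGroup M] [Module S M] :
    TensorProduct ℤ T (T →ₗ[S] M) →ₗ[ℤ] M :=
  TensorProduct.lift
    (LinearMap.mk₂ ℤ (fun t h => h t)
      (fun t₁ t₂ h => by show h (t₁ + t₂) = h t₁ + h t₂; rw [map_add])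
      (fun z t h => by show h (z • t) = z • h t; rw [map_zsmul])
      (fun t h₁ h₂ => rfl)
      (fun z t h => rfl))

/-- `Tor^R_i(T, N) = 0` for all `i ≥ 1`: for every projective resolution `P_•` of the left
`R`-module `N`, the induced complex `T ⊗_R P_•` is exact in positive degrees (expressed
via the presentation of `T ⊗_R -` as a quotient of `T ⊗_ℤ -` by the balancing relations). -/
def TorVanishPos (R : Type u) [Ring R] (T : Type u) [AddCommGroup T] [Module Rᵐᵒᵖ T]
    (N : Type u) [AddCommGroup N] [Module R N] : Prop :=
  ∀ (P : ℕ → ModuleCat.{u} R) (d : ∀ i, ↥(P (i + 1)) →ₗ[R] ↥(P i)) (ε : ↥(P 0) →ₗ[R] N),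
    (∀ i, Module.Projective R ↥(P i)) → Function.Surjective ε →
    Function.Exact (d 0) ε → (∀ i, Function.Exact (d (i + 1)) (d i)) →
    ∀ (i : ℕ) (x : TensorProduct ℤ T ↥(P (i + 1))),
      TensorProduct.map (LinearMap.id : T →ₗ[ℤ] T)
          ((d i).toAddMonoidHom.toIntLinearMap) x ∈ TensorRel R T ↥(P i) →
      ∃ y : TensorProduct ℤ T ↥(P (i + 2)),
        x - TensorProduct.map (LinearMap.id : T →ₗ[ℤ] T)
          ((d (i + 1)).toAddMonoidHom.toIntLinearMap) y ∈ TensorRel R T ↥(P (i + 1))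

/-- `M` belongs to the Bass class `B_T(S)`: the evaluation map
`T ⊗_R Hom_S(T, M) → M` is an isomorphism (it is surjective, and its kernel is exactly the
subgroup of balancing relations), `Ext^i_S(T, M) = 0` and `Tor^R_i(T, Hom_S(T, M)) = 0`
for all `i ≥ 1`. -/
def MemBass (S R : Type u) [Ring S] [Ring R] (T : Type u) [AddCommGroup T] [Module S T]
    [Module Rᵐᵒᵖ T] [SMulCommClass S Rᵐᵒᵖ T] (M : Type u) [AddCommGroup M] [Module S M] :
    Prop :=
  letI := homModule S R T M
  Function.Surjective (evalMap S T M) ∧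
  (∀ x, evalMap S T M x = 0 ↔ x ∈ TensorRel R T (T →ₗ[S] M)) ∧
  (∀ i, 1 ≤ i → ExtVanish S i (ModuleCat.of S T) (ModuleCat.of S M)) ∧
  TorVanishPos R T (T →ₗ[S] M)

/-- `R` is a left max ring: every nonzero left `R`-module has a maximal (proper) submodule. -/
def IsLeftMaxRing (R : Type u) [Ring R] : Prop :=
  ∀ (M : Type u) [AddCommGroup M] [Module R M], Nontrivial M → ∃ N : Submodule R M, IsCoatom N

/-- `R` is left Kasch: every simple quotient `R/n` by a maximal left ideal embeds as a
left ideal of `R`. -/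
def IsLeftKasch (R : Type u) [Ring R] : Prop :=
  ∀ n : Submodule R R, IsCoatom n → ∃ I : Submodule R R, Nonempty ((R ⧸ n) ≃ₗ[R] ↥I)


/-- The dual basis lemma for finitely generated projective right modules. -/
theorem exists_finite_dual_basis (R : Type u) [Ring R] (P : Type u) [AddCommGroup P]
    [Module Rᵐᵒᵖ P] [Module.Finite Rᵐᵒᵖ P] [Module.Projective Rᵐᵒᵖ P] :
    ∃ (n : ℕ) (p : Fin n → P) (π : Fin n → P →ₗ[Rᵐᵒᵖ] R),
      ∀ x, ∑ k, MulOpposite.op (π k x) • p k = x := by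
  obtain ⟨n, f, g, -, -, hfg⟩ := Module.Finite.exists_comp_eq_id_of_projective Rᵐᵒᵖ P
  refine ⟨n, fun k => f (Pi.single k 1), fun k =>
    { toFun := fun x => (g x k).unop
      map_add' := fun x y => by simp
      map_smul' := fun r x => by simp [MulOpposite.smul_eq_mul_unop] }, fun x => ?_⟩
  have hx : f (g x) = x := LinearMap.congr_fun hfg x
  conv_rhs => rw [← hx, pi_eq_sum_univ' (g x), map_sum]
  refine Finset.sum_congr rfl fun k _ => ?_
  rw [← map_smul]
  congr 1

/-- If every map `P → T` extends along `ι : P → X`, where `P` and `X` are finitely generated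
projective and `T` is tensorly faithful, then every functional on `P` extends along `ι`. -/
theorem TensorlyFaithful.exists_extension {R : Type u} [Ring R] {T : Type u} [AddCommGroup T]
    [Module Rᵐᵒᵖ T] (hT : TensorlyFaithful R T) {P X : Type u} [AddCommGroup P] [AddCommGroup X]
    [Module Rᵐᵒᵖ P] [Module Rᵐᵒᵖ X] [Module.Finite Rᵐᵒᵖ P] [Module.Projective Rᵐᵒᵖ P]
    [Module.Finite Rᵐᵒᵖ X] [Module.Projective Rᵐᵒᵖ X] (ι : P →ₗ[Rᵐᵒᵖ] X)
    (hι : ∀ h : P →ₗ[Rᵐᵒᵖ] T, ∃ g : X →ₗ[Rᵐᵒᵖ] T, g ∘ₗ ι = h) (φ : P →ₗ[Rᵐᵒᵖ] R) :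
    ∃ ξ : X →ₗ[Rᵐᵒᵖ] R, ξ ∘ₗ ι = φ := by
  let N : Submodule R (P →ₗ[Rᵐᵒᵖ] R) :=
    { carrier := {φ | ∃ ξ : X →ₗ[Rᵐᵒᵖ] R, ξ ∘ₗ ι = φ}
      add_mem' := by
        rintro _ _ ⟨ξ, rfl⟩ ⟨ζ, rfl⟩
        exact ⟨ξ + ζ, LinearMap.add_comp _ _ _⟩
      zero_mem' := ⟨0, LinearMap.zero_comp _⟩
      smul_mem' := by
        rintro r _ ⟨ξ, rfl⟩
        exact ⟨r • ξ, LinearMap.smul_comp _ _ _⟩ }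
  by_contra hφ
  have hnt : Nontrivial ((P →ₗ[Rᵐᵒᵖ] R) ⧸ N) :=
    Submodule.Quotient.nontrivial_iff.mpr fun h => hφ (h ▸ Submodule.mem_top : φ ∈ N)
  refine hT _ hnt ?_
  obtain ⟨n, p, π, hp⟩ := exists_finite_dual_basis R P
  obtain ⟨m, x, ξ, hx⟩ := exists_finite_dual_basis R X
  have expand (ψ : P →ₗ[Rᵐᵒᵖ] R) : ∑ k, ψ (p k) • π k = ψ := by
    ext y
    conv_rhs => rw [← hp y, map_sum]
    simp [LinearMap.sum_apply]
  let q := QuotientAddGroup.mk' (TensorRel R T ((P →ₗ[Rᵐᵒᵖ] R) ⧸ N))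
  have hq (t : T) (r : R) (y) : q (t ⊗ₜ[ℤ] (r • y)) = q ((MulOpposite.op r • t) ⊗ₜ[ℤ] y) := by
    rw [eq_comm, ← sub_eq_zero, ← map_sub]
    exact (QuotientAddGroup.eq_zero_iff _).mpr (AddSubgroup.subset_closure ⟨t, r, y, rfl⟩)
  have pure (t : T) (ψ : P →ₗ[Rᵐᵒᵖ] R) : q (t ⊗ₜ[ℤ] N.mkQ ψ) = 0 := by
    obtain ⟨g, hg⟩ := hι
      { toFun := fun y => MulOpposite.op (ψ y) • t
        map_add' := fun y z => by simp [add_smul]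
        map_smul' := fun r y => by simp [mul_smul] }
    have hg' (y : P) : MulOpposite.op (ψ y) • t = g (ι y) := (LinearMap.congr_fun hg y).symm
    calc q (t ⊗ₜ[ℤ] N.mkQ ψ)
        = ∑ k, q ((g (ι (p k))) ⊗ₜ[ℤ] N.mkQ (π k)) := by
          conv_lhs => rw [← expand ψ]
          simp only [map_sum, map_smul, TensorProduct.tmul_sum, hq, hg']
      _ = ∑ k, ∑ j, q (g (x j) ⊗ₜ[ℤ] N.mkQ (ξ j (ι (p k)) • π k)) := by
          refine Finset.sum_congr rfl fun k _ => ?_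
          conv_lhs => rw [← hx (ι (p k))]
          simp only [map_sum, map_smul, TensorProduct.sum_tmul, hq]
      _ = ∑ j, q (g (x j) ⊗ₜ[ℤ] N.mkQ (ξ j ∘ₗ ι)) := by
          rw [Finset.sum_comm]
          refine Finset.sum_congr rfl fun j _ => ?_
          conv_rhs => rw [← expand (ξ j ∘ₗ ι)]
          simp only [map_sum, TensorProduct.tmul_sum, LinearMap.comp_apply]
      _ = 0 := Finset.sum_eq_zero fun j _ => by
          have : N.mkQ (ξ j ∘ₗ ι) = 0 := (Submodule.Quotient.mk_eq_zero _).mpr ⟨ξ j, rfl⟩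
          rw [this, TensorProduct.tmul_zero, map_zero]
  refine eq_top_iff.mpr fun z _ => (QuotientAddGroup.eq_zero_iff z).mp ?_
  change q z = 0
  induction z with
  | zero => exact map_zero q
  | add a b ha hb => rw [map_add, ha trivial, hb trivial, add_zero]
  | tmul t y =>
    obtain ⟨ψ, rfl⟩ := N.mkQ_surjective y
    exact pure t ψ

/-- A module presented by a finitely generated projective module with finitely generated
projective kernel is projective if all maps from the kernel to some tensorly faithful module
extend. -/
theorem TensorlyFaithful.projective_of_extension {R : Type u} [Ring R] {T : Type u}
    [AddCommGroup T] [Module Rᵐᵒᵖ T] (hT : TensorlyFaithful R T) {P X K : Type u}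
    [AddCommGroup P] [AddCommGroup X] [AddCommGroup K]
    [Module Rᵐᵒᵖ P] [Module Rᵐᵒᵖ X] [Module Rᵐᵒᵖ K] [Module.Finite Rᵐᵒᵖ P]
    [Module.Projective Rᵐᵒᵖ P] [Module.Finite Rᵐᵒᵖ X] [Module.Projective Rᵐᵒᵖ X]
    {ι : P →ₗ[Rᵐᵒᵖ] X} {g : X →ₗ[Rᵐᵒᵖ] K} (hinj : Function.Injective ι)
    (hex : Function.Exact ι g) (hsurj : Function.Surjective g)
    (hι : ∀ h : P →ₗ[Rᵐᵒᵖ] T, ∃ g : X →ₗ[Rᵐᵒᵖ] T, g ∘ₗ ι = h) :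
    Module.Projective Rᵐᵒᵖ K := by
  obtain ⟨n, p, π, hp⟩ := exists_finite_dual_basis R P
  choose ρ hρ using fun k => hT.exists_extension ι hι (π k)
  let s : X →ₗ[Rᵐᵒᵖ] P :=
    { toFun := fun x => ∑ k, MulOpposite.op (ρ k x) • p k
      map_add' := fun x y => by simp [add_smul, Finset.sum_add_distrib]
      map_smul' := fun r x => by simp [mul_smul, Finset.smul_sum] }
  have hs : s ∘ₗ ι = LinearMap.id := by
    ext y
    conv_rhs => rw [LinearMap.id_apply, ← hp y]
    simp only [← hρ]
    rfl
  obtain ⟨l, hl⟩ : ∃ l, g ∘ₗ l = LinearMap.id :=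
    ((hex.split_tfae hinj hsurj).out 0 1 (a := ∃ l, g ∘ₗ l = LinearMap.id)
      (b := ∃ l, l ∘ₗ ι = LinearMap.id)).mpr ⟨s, hs⟩
  exact Module.Projective.of_split l g hl

theorem MemAdd.finite_projective {A : Type u} [Ring A] {N : ModuleCat.{u} A}
    (h : MemAdd A (ModuleCat.of A A) N) : Module.Finite A N ∧ Module.Projective A N := by
  obtain ⟨k, M, ⟨e⟩⟩ := h
  have hfin : Module.Finite A (Fin k → A) := inferInstance
  have hproj : Module.Projective A (Fin k → A) := inferInstance
  let i : N →ₗ[A] (Fin k → A) := e.toLinearMap ∘ₗ LinearMap.inl A N M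
  let r : (Fin k → A) →ₗ[A] N := LinearMap.fst A N M ∘ₗ e.symm.toLinearMap
  have hri : ∀ y, r (i y) = y := fun y => by simp [i, r]
  exact ⟨Module.Finite.of_surjective r fun y => ⟨i y, hri y⟩,
    Module.Projective.of_split i r (LinearMap.ext hri)⟩

/-- The chain complex of modules attached to a sequence of linear maps. -/
noncomputable def linearMapChainComplex {A : Type u} [Ring A] (X : ℕ → ModuleCat.{u} A)
    (f : ∀ i, ↥(X (i + 1)) →ₗ[A] ↥(X i)) (hff : ∀ i, Function.Exact (f (i + 1)) (f i)) :
    ChainComplex (ModuleCat.{u} A) ℕ :=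
  ChainComplex.of X (fun i => ModuleCat.ofHom (f i)) fun i => by
    ext x; exact (hff i).apply_apply_eq_zero x

section Resolution

variable {A : Type u} [Ring A] {M : ModuleCat.{u} A} {X : ℕ → ModuleCat.{u} A}
  {f : ∀ i, ↥(X (i + 1)) →ₗ[A] ↥(X i)} {f0 : ↥(X 0) →ₗ[A] ↥M}

theorem linearMapChainComplex_d (hff : ∀ i, Function.Exact (f (i + 1)) (f i)) (i : ℕ) :
    (linearMapChainComplex X f hff).d (i + 1) i = ModuleCat.ofHom (f i) :=
  ChainComplex.of_d X (fun i => ModuleCat.ofHom (f i)) i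

theorem exists_projectiveResolution (hX : ∀ i, Module.Projective A (X i))
    (hf0 : Function.Surjective f0) (hf : Function.Exact (f 0) f0)
    (hff : ∀ i, Function.Exact (f (i + 1)) (f i)) :
    ∃ P : ProjectiveResolution M, P.complex = linearMapChainComplex X f hff := by
  let C := linearMapChainComplex X f hff
  have w : C.d 1 0 ≫ ModuleCat.ofHom f0 = 0 := by
    rw [linearMapChainComplex_d]; ext x; exact hf.apply_apply_eq_zero x
  refine ⟨{ complex := C
            projective := fun n => (IsProjective.iff_projective _).mp (hX n)
            π := (C.toSingle₀Equiv M).symm ⟨ModuleCat.ofHom f0, w⟩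
            quasiIso := ⟨fun m => ?_⟩ }, rfl⟩
  cases m with
  | zero =>
    rw [ChainComplex.quasiIsoAt₀_iff, ShortComplex.quasiIso_iff_of_zeros' _ rfl rfl rfl]
    have h0 : ((C.toSingle₀Equiv M).symm ⟨ModuleCat.ofHom f0, w⟩).f 0 = ModuleCat.ofHom f0 :=
      ChainComplex.toSingle₀Equiv_symm_apply_f_zero _ _
    constructor
    · rw [ShortComplex.ShortExact.moduleCat_exact_iff_function_exact]
      change Function.Exact (C.d 1 0) (((C.toSingle₀Equiv M).symm ⟨ModuleCat.ofHom f0, w⟩).f 0)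
      rw [h0, linearMapChainComplex_d]
      exact hf
    · rw [ModuleCat.epi_iff_surjective]
      change Function.Surjective (((C.toSingle₀Equiv M).symm ⟨ModuleCat.ofHom f0, w⟩).f 0)
      rw [h0]
      exact hf0
  | succ m =>
    rw [quasiIsoAt_iff_exactAt' (hL := ChainComplex.exactAt_succ_single_obj ..),
      HomologicalComplex.exactAt_iff' _ (m + 2) (m + 1) m (by simp) (by simp),
      ShortComplex.ShortExact.moduleCat_exact_iff_function_exact]
    change Function.Exact (C.d (m + 2) (m + 1)) (C.d (m + 1) m)
    rw [linearMapChainComplex_d, linearMapChainComplex_d]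
    exact hff m

theorem ExtVanish.exists_factorization {Y : ModuleCat.{u} A} {n : ℕ}
    (hY : ExtVanish A (n + 1) M Y) (hX : ∀ i, Module.Projective A (X i))
    (hf0 : Function.Surjective f0) (hf : Function.Exact (f 0) f0)
    (hff : ∀ i, Function.Exact (f (i + 1)) (f i))
    (h : X (n + 1) →ₗ[A] Y) (hh : h ∘ₗ f (n + 1) = 0) :
    ∃ g : X n →ₗ[A] Y, g ∘ₗ f n = h := by
  obtain ⟨P, hP⟩ := exists_projectiveResolution hX hf0 hf hff
  have hz := (ModuleCat.isZero_of_subsingleton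
    (((Ext ℤ (ModuleCat.{u} A) (n + 1)).obj (Opposite.op M)).obj Y)).of_iso
    (P.isoExt (n + 1) Y).symm
  rw [← HomologicalComplex.exactAt_iff_isZero_homology,
    HomologicalComplex.exactAt_iff' _ n (n + 1) (n + 2) (by simp) (by simp),
    ShortComplex.moduleCat_exact_iff, hP] at hz
  obtain ⟨g, hg⟩ := hz (ModuleCat.ofHom h) (by
    change (linearMapChainComplex X f hff).d (n + 2) (n + 1) ≫ ModuleCat.ofHom h = 0
    rw [linearMapChainComplex_d]
    ext x
    exact LinearMap.congr_fun hh x)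
  change (linearMapChainComplex X f hff).d (n + 1) n ≫ g = ModuleCat.ofHom h at hg
  rw [linearMapChainComplex_d] at hg
  exact ⟨g.hom, LinearMap.ext fun x => ConcreteCategory.congr_hom hg x⟩

end Resolution

section Syzygy

variable {A : Type u} [Ring A] {M X Y Z : Type u} [AddCommGroup M] [Module A M]
  [AddCommGroup X] [Module A X] [AddCommGroup Y] [Module A Y] [AddCommGroup Z] [Module A Z]
  {g : Y →ₗ[A] X} {f : X →ₗ[A] M}

theorem Function.Exact.surjective_codRestrict_ker (hgf : Function.Exact g f) :
    Function.Surjective (g.codRestrict (LinearMap.ker f) hgf.apply_apply_eq_zero) := by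
  rintro ⟨x, hx⟩
  obtain ⟨y, rfl⟩ := (hgf x).mp hx
  exact ⟨y, rfl⟩

theorem Function.Exact.exact_codRestrict_ker (hgf : Function.Exact g f) {h : Z →ₗ[A] Y}
    (hhg : Function.Exact h g) :
    Function.Exact h (g.codRestrict (LinearMap.ker f) hgf.apply_apply_eq_zero) := fun y => by
  rw [← hhg y, Subtype.ext_iff]
  rfl

theorem hasProjectiveDimensionLT_ker_iff [Module.Projective A X] (hf : Function.Surjective f)
    (n : ℕ) : HasProjectiveDimensionLT (ModuleCat.of A (LinearMap.ker f)) (n + 1) ↔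
      HasProjectiveDimensionLT (ModuleCat.of A M) (n + 2) := by
  let E : ShortComplex (ModuleCat.{u} A) :=
    ShortComplex.mk (ModuleCat.ofHom (LinearMap.ker f).subtype) (ModuleCat.ofHom f) (by
      ext x; exact x.2)
  have hE : E.ShortExact :=
    { exact := by
        rw [ShortComplex.ShortExact.moduleCat_exact_iff_function_exact]
        exact LinearMap.exact_subtype_ker_map f
      mono_f := (ModuleCat.mono_iff_injective _).mpr (LinearMap.ker f).injective_subtype
      epi_g := (ModuleCat.epi_iff_surjective _).mpr hf }
  exact (hE.hasProjectiveDimensionLT_X₃_iff n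
    ((IsProjective.iff_projective X).mp inferInstance)).symm

end Syzygy

theorem PdLE.hasProjectiveDimensionLT {A : Type u} [Ring A] {n : ℕ} {M : ModuleCat.{u} A}
    (h : PdLE A M n) : HasProjectiveDimensionLT M (n + 1) := by
  induction n generalizing M with
  | zero =>
    obtain ⟨P, d, ε, hP, hε, hd, -, hsub⟩ := h
    have := hsub 1 one_pos
    have hinj : Function.Injective ε := by
      rw [injective_iff_map_eq_zero]
      intro x hx
      obtain ⟨y, rfl⟩ := (hd x).mp hx
      rw [Subsingleton.elim y 0, map_zero]
    have := hP 0
    rw [zero_add, ← projective_iff_hasProjectiveDimensionLT_one, ← IsProjective.iff_projective]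
    exact Module.Projective.of_equiv (LinearEquiv.ofBijective ε ⟨hinj, hε⟩)
  | succ n ih =>
    obtain ⟨P, d, ε, hP, hε, hd, hdd, hsub⟩ := h
    have := hP 0
    refine (hasProjectiveDimensionLT_ker_iff hε n).mp (ih ?_)
    exact ⟨fun i => P (i + 1), fun i => d (i + 1),
      (d 0).codRestrict (LinearMap.ker ε) hd.apply_apply_eq_zero, fun i => hP (i + 1),
      hd.surjective_codRestrict_ker, hd.exact_codRestrict_ker (hdd 0), fun i => hdd (i + 1),
      fun i hi => hsub (i + 1) (by omega)⟩

/-- A module of finite projective dimension with a resolution by finitely generated projective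
modules is projective if that resolution becomes exact in positive degrees after applying
`Hom(-, T)`, for some tensorly faithful `T`. -/
theorem TensorlyFaithful.projective_of_hasProjectiveDimensionLT {R : Type u} [Ring R]
    {T : Type u} [AddCommGroup T] [Module Rᵐᵒᵖ T] (hT : TensorlyFaithful R T) {n : ℕ}
    {M : ModuleCat.{u} Rᵐᵒᵖ} (hM : HasProjectiveDimensionLT M (n + 1))
    {X : ℕ → ModuleCat.{u} Rᵐᵒᵖ} {f : ∀ i, ↥(X (i + 1)) →ₗ[Rᵐᵒᵖ] ↥(X i)}
    {f0 : ↥(X 0) →ₗ[Rᵐᵒᵖ] ↥M} (hfin : ∀ i, Module.Finite Rᵐᵒᵖ (X i))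
    (hproj : ∀ i, Module.Projective Rᵐᵒᵖ (X i)) (hf0 : Function.Surjective f0)
    (hf : Function.Exact (f 0) f0) (hff : ∀ i, Function.Exact (f (i + 1)) (f i))
    (hext : ∀ (i : ℕ) (h : X (i + 1) →ₗ[Rᵐᵒᵖ] T), h ∘ₗ f (i + 1) = 0 →
      ∃ g : X i →ₗ[Rᵐᵒᵖ] T, g ∘ₗ f i = h) :
    Module.Projective Rᵐᵒᵖ M := by
  induction n generalizing M X with
  | zero =>
    rwa [IsProjective.iff_projective, projective_iff_hasProjectiveDimensionLT_one]
  | succ n ih =>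
    have := hfin 0
    have := hfin 1
    have := hproj 0
    have hsurj := hf.surjective_codRestrict_ker
    have : Module.Finite Rᵐᵒᵖ (LinearMap.ker f0) := Module.Finite.of_surjective _ hsurj
    have : Module.Projective Rᵐᵒᵖ (LinearMap.ker f0) :=
      ih (M := ModuleCat.of Rᵐᵒᵖ (LinearMap.ker f0)) (X := fun i => X (i + 1))
        (f := fun i => f (i + 1)) ((hasProjectiveDimensionLT_ker_iff hf0 n).mpr hM)
        (fun i => hfin (i + 1)) (fun i => hproj (i + 1)) hsurj
        (hf.exact_codRestrict_ker (hff 0)) (fun i => hff (i + 1)) (fun i => hext (i + 1))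
    refine hT.projective_of_extension (LinearMap.ker f0).injective_subtype
      (LinearMap.exact_subtype_ker_map f0) hf0 fun h => ?_
    obtain ⟨g, hg⟩ := hext 0
      (h ∘ₗ (f 0).codRestrict (LinearMap.ker f0) hf.apply_apply_eq_zero) (by
        ext x
        have : (f 0).codRestrict (LinearMap.ker f0) hf.apply_apply_eq_zero (f 1 x) = 0 :=
          Subtype.ext ((hff 0).apply_apply_eq_zero x)
        simp only [LinearMap.comp_apply, LinearMap.zero_apply]
        exact (congrArg h this).trans (map_zero h))
    refine ⟨g, LinearMap.ext fun y => ?_⟩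
    obtain ⟨x, rfl⟩ := hsurj y
    exact LinearMap.congr_fun hg x

/-- Theorem 2.10. Let `T` be a Wakamatsu tilting (i.e. semidualizing)
`(S,R)`-bimodule. If `T` has finite projective dimension as a right `R`-module and `T` is
tensorly faithful, then `T` is projective as a right `R`-module. -/
theorem wakamatsu_tilting_tensorly_faithful_finite_pd_projective
    (S R : Type u) [Ring S] [Ring R] (T : Type u) [AddCommGroup T] [Module S T]
    [Module Rᵐᵒᵖ T] [SMulCommClass S Rᵐᵒᵖ T]
    (hsd : IsSemidualizing S R T)
    (hpd : ∃ n : ℕ, PdLE Rᵐᵒᵖ (ModuleCat.of Rᵐᵒᵖ T) n)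
    (hfaith : TensorlyFaithful R T) :
    Module.Projective Rᵐᵒᵖ T := by
  obtain ⟨⟨X, f, f0, hX, hf0, hf, hff, -, -⟩, -, -, -, hT, -⟩ := hsd
  obtain ⟨n, hn⟩ := hpd
  have hproj i := (hX i).finite_projective.2
  exact hfaith.projective_of_hasProjectiveDimensionLT hn.hasProjectiveDimensionLT
    (fun i => (hX i).finite_projective.1) hproj hf0 hf hff fun i =>
      (hT (i + 1) i.succ_pos).exists_factorization hproj hf0 hf hff
end

section
/- Let S and R be associative rings with identity and let T be an (S,R)-bimodule that is Wakamatsu tilting. Assume the projective dimension of T as a right R-module is finite. If the generalized Auslander–Reiten conjecture holds for S (i.e., for every finitely generated left S-module M and every integer n ≥ 0, the vanishing Ext^i_S(M, M ⊕ S) = 0 for all i > n implies pd(_S M) ≤ n), then T is a tilting right R-module, i.e., T is an n-tilting module for n = pd(T_R). -/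
/-!
Common definitions for formalizing the Wakamatsu tilting conjecture paper.
All rings are associative with identity; right `R`-modules are treated as
left `Rᵐᵒᵖ`-modules.
-/

open CategoryTheory

universe u

section Resolution

variable {S : Type u} [Ring S]

/-- The chain complex attached to a sequence of composable linear maps that is exact. -/
noncomputable def resolutionComplex (P : ℕ → ModuleCat.{u} S)
    (d : ∀ i, ↥(P (i + 1)) →ₗ[S] ↥(P i)) (hd : ∀ i, Function.Exact (d (i + 1)) (d i)) :
    ChainComplex (ModuleCat.{u} S) ℕ :=
  ChainComplex.of P (fun i => ModuleCat.ofHom (d i)) (fun i => by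
    ext x
    exact (hd i).apply_apply_eq_zero x)

lemma resolutionComplex_d {P : ℕ → ModuleCat.{u} S}
    {d : ∀ i, ↥(P (i + 1)) →ₗ[S] ↥(P i)} (hd : ∀ i, Function.Exact (d (i + 1)) (d i)) (i : ℕ) :
    (resolutionComplex P d hd).d (i + 1) i = ModuleCat.ofHom (d i) :=
  ChainComplex.of_d P (fun i => ModuleCat.ofHom (d i)) i

/-- The augmentation of `resolutionComplex` given by an augmented exact sequence. -/
noncomputable def resolutionAugmentation {X : ModuleCat.{u} S} {P : ℕ → ModuleCat.{u} S}
    {d : ∀ i, ↥(P (i + 1)) →ₗ[S] ↥(P i)} {ε : ↥(P 0) →ₗ[S] ↥X}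
    (h0 : Function.Exact (d 0) ε) (hd : ∀ i, Function.Exact (d (i + 1)) (d i)) :
    resolutionComplex P d hd ⟶ (ChainComplex.single₀ _).obj X :=
  (ChainComplex.toSingle₀Equiv _ _).symm ⟨ModuleCat.ofHom ε, by
    rw [resolutionComplex_d]
    ext x
    exact h0.apply_apply_eq_zero x⟩

lemma resolutionAugmentation_f_zero {X : ModuleCat.{u} S} {P : ℕ → ModuleCat.{u} S}
    {d : ∀ i, ↥(P (i + 1)) →ₗ[S] ↥(P i)} {ε : ↥(P 0) →ₗ[S] ↥X}
    (h0 : Function.Exact (d 0) ε) (hd : ∀ i, Function.Exact (d (i + 1)) (d i)) (x : ↥(P 0)) :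
    (ConcreteCategory.hom ((resolutionAugmentation h0 hd).f 0) :
      ↥(P 0) → ↥X) x = ε x :=
  congr((ConcreteCategory.hom $(ChainComplex.toSingle₀Equiv_symm_apply_f_zero
    (C := resolutionComplex P d hd) (X := X) (ModuleCat.ofHom ε) _) : ↥(P 0) → ↥X) x)

/-- An exact sequence `⋯ → P 1 → P 0 → X → 0` with all `P i` projective, as a
`ProjectiveResolution`. -/
noncomputable def resolutionOfExact {X : ModuleCat.{u} S} (P : ℕ → ModuleCat.{u} S)
    (d : ∀ i, ↥(P (i + 1)) →ₗ[S] ↥(P i)) (ε : ↥(P 0) →ₗ[S] ↥X)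
    (hP : ∀ i, Module.Projective S ↥(P i)) (hε : Function.Surjective ε)
    (h0 : Function.Exact (d 0) ε) (hd : ∀ i, Function.Exact (d (i + 1)) (d i)) :
    ProjectiveResolution X where
  complex := resolutionComplex P d hd
  projective i := (IsProjective.iff_projective (R := S) (P i)).1 (hP i)
  π := resolutionAugmentation h0 hd
  quasiIso := ⟨fun n => by
    cases n with
    | zero =>
      rw [ChainComplex.quasiIsoAt₀_iff, ShortComplex.quasiIso_iff_of_zeros' _ rfl rfl rfl]
      constructor
      · rw [ShortComplex.moduleCat_exact_iff]
        intro x hx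
        change ↥(P 0) at x
        have hx : ε x = 0 :=
          (resolutionAugmentation_f_zero h0 hd x).symm.trans hx
        obtain ⟨y, rfl⟩ := (h0 x).1 hx
        exact ⟨y, congr($(resolutionComplex_d hd 0) y)⟩
      · rw [ModuleCat.epi_iff_surjective]
        intro x
        obtain ⟨y, rfl⟩ := hε x
        exact ⟨y, resolutionAugmentation_f_zero h0 hd y⟩
    | succ n =>
      rw [quasiIsoAt_iff_exactAt']
      · rw [HomologicalComplex.exactAt_iff' _ (n + 1 + 1) (n + 1) n (by simp) (by simp),
          ShortComplex.moduleCat_exact_iff]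
        intro x hx
        have hx : d n x = 0 := congr($(resolutionComplex_d hd n) x).symm.trans hx
        obtain ⟨y, rfl⟩ := (hd n x).1 hx
        exact ⟨y, congr($(resolutionComplex_d hd (n + 1)) y)⟩
      · exact ChainComplex.exactAt_succ_single_obj _ _⟩

/-- `Ext^(i+1)(X, Y)` is computed by any projective resolution of `X`. -/
lemma extVanish_succ_iff {X : ModuleCat.{u} S} {P : ℕ → ModuleCat.{u} S}
    {d : ∀ i, ↥(P (i + 1)) →ₗ[S] ↥(P i)} {ε : ↥(P 0) →ₗ[S] ↥X}
    (hP : ∀ i, Module.Projective S ↥(P i)) (hε : Function.Surjective ε)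
    (h0 : Function.Exact (d 0) ε) (hd : ∀ i, Function.Exact (d (i + 1)) (d i))
    (i : ℕ) (Y : ModuleCat.{u} S) :
    ExtVanish S (i + 1) X Y ↔ ∀ f : ↥(P (i + 1)) →ₗ[S] ↥Y, f ∘ₗ d (i + 1) = 0 →
      ∃ g : ↥(P i) →ₗ[S] ↥Y, g ∘ₗ d i = f := by
  have e := (resolutionOfExact P d ε hP hε h0 hd).isoExt (R := ℤ) (i + 1) Y
  rw [ExtVanish, e.toLinearEquiv.toEquiv.subsingleton_congr, ← ModuleCat.isZero_iff_subsingleton,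
    ← HomologicalComplex.exactAt_iff_isZero_homology,
    HomologicalComplex.exactAt_iff' _ i (i + 1) (i + 1 + 1) (by simp) (by simp),
    ShortComplex.moduleCat_exact_iff]
  have hc : ∀ i, (resolutionOfExact P d ε hP hε h0 hd).complex.d (i + 1) i =
    ModuleCat.ofHom (d i) := resolutionComplex_d hd
  constructor
  · intro H f hf
    obtain ⟨g, hg⟩ := H (ModuleCat.ofHom f) <| by
      change (resolutionOfExact P d ε hP hε h0 hd).complex.d (i + 1 + 1) (i + 1) ≫ _ = 0
      rw [hc]
      exact congr(ModuleCat.ofHom $hf)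
    change (resolutionOfExact P d ε hP hε h0 hd).complex.d (i + 1) i ≫ g = _ at hg
    rw [hc] at hg
    exact ⟨ModuleCat.Hom.hom g, congr(ModuleCat.Hom.hom $hg)⟩
  · intro H f hf
    change (resolutionOfExact P d ε hP hε h0 hd).complex.d (i + 1 + 1) (i + 1) ≫ f = 0 at hf
    rw [hc] at hf
    obtain ⟨g, hg⟩ := H (ModuleCat.Hom.hom f) congr(ModuleCat.Hom.hom $hf)
    refine ⟨ModuleCat.ofHom g, ?_⟩
    change (resolutionOfExact P d ε hP hε h0 hd).complex.d (i + 1) i ≫ _ = _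
    rw [hc]
    exact ModuleCat.hom_ext hg

end Resolution

section Summands

variable {S : Type u} [Ring S]

lemma memAdd_of_retract {T N : ModuleCat.{u} S} {k : ℕ} (ι : ↥N →ₗ[S] (Fin k → ↥T))
    (π : (Fin k → ↥T) →ₗ[S] ↥N) (h : ∀ x, π (ι x) = x) : MemAdd S T N :=
  ⟨k, ModuleCat.of S (LinearMap.ker π),
    ⟨LinearEquiv.ofLinearMap (ι.coprod (LinearMap.ker π).subtype)
      (π.prod ((LinearMap.id - ι ∘ₗ π).codRestrict (LinearMap.ker π) fun x => by simp [h]))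
      (by ext x; simp) (by ext x <;> simp [h])⟩⟩

lemma MemAdd.exists_retract {T N : ModuleCat.{u} S} (hN : MemAdd S T N) :
    ∃ (k : ℕ) (ι : ↥N →ₗ[S] (Fin k → ↥T)) (π : (Fin k → ↥T) →ₗ[S] ↥N), ∀ x, π (ι x) = x := by
  obtain ⟨k, M, ⟨e⟩⟩ := hN
  exact ⟨k, e.toLinearMap ∘ₗ LinearMap.inl S ↥N ↥M,
    LinearMap.fst S ↥N ↥M ∘ₗ e.symm.toLinearMap, fun x => by simp⟩

lemma MemAdd.of_retract {T N N' : ModuleCat.{u} S} (hN : MemAdd S T N) (i : ↥N' →ₗ[S] ↥N)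
    (r : ↥N →ₗ[S] ↥N') (h : ∀ x, r (i x) = x) : MemAdd S T N' := by
  obtain ⟨k, ι, π, hπ⟩ := hN.exists_retract
  exact memAdd_of_retract (ι ∘ₗ i) (r ∘ₗ π) fun x => by simp [hπ, h]

lemma MemAdd.projective {N : ModuleCat.{u} S} (hN : MemAdd S (ModuleCat.of S S) N) :
    Module.Projective S ↥N := by
  obtain ⟨k, ι, π, hπ⟩ := hN.exists_retract
  exact Module.Projective.of_split (P := N) (M := Fin k → S) ι π (LinearMap.ext hπ)

lemma MemAdd.finite {N : ModuleCat.{u} S} (hN : MemAdd S (ModuleCat.of S S) N) :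
    Module.Finite S ↥N := by
  obtain ⟨k, ι, π, hπ⟩ := hN.exists_retract
  exact Module.Finite.of_surjective (M := Fin k → S) π fun x => ⟨ι x, hπ x⟩

end Summands

section HomExact

variable {S : Type u} [Ring S]

/-- The complex `Hom_S(P_•, Y)` is exact in degree `i + 1`. -/
def HomExactAt (P : ℕ → ModuleCat.{u} S) (d : ∀ i, ↥(P (i + 1)) →ₗ[S] ↥(P i)) (i : ℕ)
    (Y : Type u) [AddCommGroup Y] [Module S Y] : Prop :=
  ∀ f : ↥(P (i + 1)) →ₗ[S] Y, f ∘ₗ d (i + 1) = 0 → ∃ g : ↥(P i) →ₗ[S] Y, g ∘ₗ d i = f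

lemma PdLE.extVanish {X : ModuleCat.{u} S} {n : ℕ} (h : PdLE S X n) (Y : ModuleCat.{u} S) :
    ExtVanish S (n + 1) X Y := by
  obtain ⟨P, d, ε, hP, hε, h0, hd, hn⟩ := h
  rw [extVanish_succ_iff hP hε h0 hd]
  intro f _
  have := hn (n + 1) n.lt_succ_self
  exact ⟨0, LinearMap.ext fun x => by simp [Subsingleton.elim x 0]⟩

lemma exists_lift_of_exact {X Y Z W : Type*} [AddCommGroup X] [Module S X]
    [AddCommGroup Y] [Module S Y] [AddCommGroup Z] [Module S Z] [AddCommGroup W] [Module S W]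
    {i : X →ₗ[S] Y} {p : Y →ₗ[S] Z} (hi : Function.Injective i) (hip : Function.Exact i p)
    (h : W →ₗ[S] Y) (hh : p ∘ₗ h = 0) : ∃ k : W →ₗ[S] X, i ∘ₗ k = h := by
  refine ⟨(LinearEquiv.ofInjective i hi).symm.toLinearMap ∘ₗ
    h.codRestrict (LinearMap.range i) fun x => (hip _).1 congr($hh x), ?_⟩
  ext x
  exact congr_arg Subtype.val ((LinearEquiv.ofInjective i hi).apply_symm_apply _)

lemma exists_desc_of_exact {X Y Z W : Type*} [AddCommGroup X] [Module S X]
    [AddCommGroup Y] [Module S Y] [AddCommGroup Z] [Module S Z] [AddCommGroup W] [Module S W]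
    {i : X →ₗ[S] Y} {p : Y →ₗ[S] Z} (hp : Function.Surjective p) (hip : Function.Exact i p)
    (h : Y →ₗ[S] W) (hh : h ∘ₗ i = 0) : ∃ k : Z →ₗ[S] W, k ∘ₗ p = h := by
  refine ⟨(LinearMap.ker p).liftQ h (fun y hy => ?_) ∘ₗ
    (p.quotKerEquivOfSurjective hp).symm.toLinearMap, ?_⟩
  · obtain ⟨x, rfl⟩ := (hip y).1 hy
    exact congr($hh x)
  · ext y
    have : (p.quotKerEquivOfSurjective hp).symm (p y) = Submodule.Quotient.mk y := by
      rw [LinearEquiv.symm_apply_eq]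
      rfl
    simp [this]

variable {P : ℕ → ModuleCat.{u} S} {d : ∀ i, ↥(P (i + 1)) →ₗ[S] ↥(P i)} {i : ℕ}

lemma HomExactAt.of_retract {Y Y' : Type u} [AddCommGroup Y] [Module S Y] [AddCommGroup Y']
    [Module S Y'] (h : HomExactAt P d i Y) (j : Y' →ₗ[S] Y) (r : Y →ₗ[S] Y')
    (hr : ∀ x, r (j x) = x) : HomExactAt P d i Y' := by
  intro f hf
  obtain ⟨g, hg⟩ := h (j ∘ₗ f) (by rw [LinearMap.comp_assoc, hf, LinearMap.comp_zero])
  exact ⟨r ∘ₗ g, by rw [LinearMap.comp_assoc, hg]; ext x; exact hr _⟩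

lemma HomExactAt.pi {ι : Type} {Y : Type u} [AddCommGroup Y] [Module S Y]
    (h : HomExactAt P d i Y) : HomExactAt P d i (ι → Y) := by
  intro f hf
  choose g hg using fun j => h (LinearMap.proj j ∘ₗ f)
    (by rw [LinearMap.comp_assoc, hf, LinearMap.comp_zero])
  refine ⟨LinearMap.pi g, ?_⟩
  ext x j
  exact congr($(hg j) x)

lemma HomExactAt.prod {Y Y' : Type u} [AddCommGroup Y] [Module S Y] [AddCommGroup Y']
    [Module S Y'] (h : HomExactAt P d i Y) (h' : HomExactAt P d i Y') :
    HomExactAt P d i (Y × Y') := by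
  intro f hf
  obtain ⟨g, hg⟩ := h (LinearMap.fst S Y Y' ∘ₗ f)
    (by rw [LinearMap.comp_assoc, hf, LinearMap.comp_zero])
  obtain ⟨g', hg'⟩ := h' (LinearMap.snd S Y Y' ∘ₗ f)
    (by rw [LinearMap.comp_assoc, hf, LinearMap.comp_zero])
  exact ⟨g.prod g', LinearMap.ext fun x => Prod.ext congr($hg x) congr($hg' x)⟩

lemma HomExactAt.of_memAdd {T N : ModuleCat.{u} S} (h : HomExactAt P d i ↥T)
    (hN : MemAdd S T N) : HomExactAt P d i ↥N := by
  obtain ⟨k, ι, π, hπ⟩ := hN.exists_retract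
  exact h.pi.of_retract ι π hπ

/-- Dimension shifting along a short exact sequence `0 → K → X → C → 0`. -/
lemma HomExactAt.shift {K X C : Type u} [AddCommGroup K] [Module S K] [AddCommGroup X]
    [Module S X] [AddCommGroup C] [Module S C] {j : K →ₗ[S] X} {p : X →ₗ[S] C}
    (hP : ∀ i, Module.Projective S ↥(P i)) (hd : ∀ i, Function.Exact (d (i + 1)) (d i))
    (hj : Function.Injective j) (hjp : Function.Exact j p) (hp : Function.Surjective p)
    (hC : HomExactAt P d i C) (hX : HomExactAt P d (i + 1) X) : HomExactAt P d (i + 1) K := by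
  intro f hf
  obtain ⟨g, hg⟩ := hX (j ∘ₗ f) (by rw [LinearMap.comp_assoc, hf, LinearMap.comp_zero])
  obtain ⟨h, hh⟩ := hC (p ∘ₗ g) (by
    rw [LinearMap.comp_assoc, hg, ← LinearMap.comp_assoc, hjp.linearMap_comp_eq_zero,
      LinearMap.zero_comp])
  have := hP i
  obtain ⟨h', rfl⟩ := Module.projective_lifting_property p h hp
  obtain ⟨k, hk⟩ := exists_lift_of_exact hj hjp (g - h' ∘ₗ d i) (by
    rw [LinearMap.comp_sub, ← LinearMap.comp_assoc, hh, sub_self])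
  refine ⟨k, LinearMap.ext fun x => hj ?_⟩
  have hx : j (k (d (i + 1) x)) = g (d (i + 1) x) - h' (d i (d (i + 1) x)) :=
    congr($hk (d (i + 1) x))
  rw [(hd i).apply_apply_eq_zero, map_zero, sub_zero] at hx
  exact hx.trans congr($hg x)

/-- If `B` has an `add T`-coresolution of length `n` and `Ext^i(X, T) = 0` for `i > 0`, then
`Ext^i(X, B) = 0` for `i > n`, in terms of a projective resolution `P` of `X`. -/
lemma HasFiniteAddCoresolution.homExactAt {T B : ModuleCat.{u} S} {n : ℕ}
    (hB : HasFiniteAddCoresolution S T B n) (hP : ∀ i, Module.Projective S ↥(P i))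
    (hd : ∀ i, Function.Exact (d (i + 1)) (d i)) (hT : ∀ i, HomExactAt P d i ↥T)
    (hi : n ≤ i) : HomExactAt P d i ↥B := by
  obtain ⟨X, g, g0, hX, hXn, hg0, hg0g, hg⟩ := hB
  have key : ∀ m k, k + m = n → ∀ i, m ≤ i → HomExactAt P d i (LinearMap.ker (g k)) := by
    intro m
    induction m with
    | zero =>
      rintro k rfl i -
      have := hXn (k + 1) k.lt_succ_self
      exact ((hT i).of_memAdd (hX k le_rfl)).of_retract (LinearMap.ker (g k)).subtype
        (LinearMap.id.codRestrict _ fun x => Subsingleton.elim _ _) fun x => rfl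
    | succ m ih =>
      intro k hk i hi
      obtain ⟨i, rfl⟩ : ∃ i', i = i' + 1 := ⟨i - 1, by omega⟩
      refine HomExactAt.shift (j := (LinearMap.ker (g k)).subtype)
        (p := (g k).codRestrict (LinearMap.ker (g (k + 1)))
          fun x => (hg k).apply_apply_eq_zero x)
        hP hd Subtype.val_injective ?_ ?_ (ih (k + 1) (by omega) i (by omega))
        ((hT _).of_memAdd (hX k (by omega)))
      · exact LinearMap.exact_iff.2
          ((LinearMap.ker_codRestrict _ _ _).trans (Submodule.range_subtype _).symm)
      · rintro ⟨y, hy⟩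
        obtain ⟨x, rfl⟩ := (hg k y).1 hy
        exact ⟨x, rfl⟩
  obtain ⟨r, hr⟩ := exists_lift_of_exact hg0 hg0g (LinearMap.ker (g 0)).subtype
    (LinearMap.ext fun x => x.2)
  exact (key n 0 (zero_add n) i hi).of_retract
    (g0.codRestrict _ fun x => hg0g.apply_apply_eq_zero x) r
    fun x => hg0 congr($hr ⟨g0 x, hg0g.apply_apply_eq_zero x⟩)

end HomExact

section Coresolution

variable {A B : Type u} [Ring A] [Ring B] {T : Type u} [AddCommGroup T] [Module A T] [Module B T]
  [SMulCommClass A B T]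

/-- Precomposition with an `A`-linear map, as a `B`-linear map between the `Hom`-modules into a
bimodule. -/
def precomp (T : Type u) [AddCommGroup T] [Module A T] [Module B T] [SMulCommClass A B T]
    {M N : Type u} [AddCommGroup M] [Module A M] [AddCommGroup N] [Module A N] (f : M →ₗ[A] N) :
    (N →ₗ[A] T) →ₗ[B] (M →ₗ[A] T) where
  toFun h := h ∘ₗ f
  map_add' _ _ := rfl
  map_smul' _ _ := rfl

lemma MemAdd.hom {N : ModuleCat.{u} A} (hN : MemAdd A (ModuleCat.of A A) N) :
    MemAdd B (ModuleCat.of B T) (ModuleCat.of B (↥N →ₗ[A] T)) := by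
  obtain ⟨k, ι, π, hπ⟩ := hN.exists_retract
  let ev : (↥N →ₗ[A] T) →ₗ[B] (Fin k → T) :=
    { toFun := fun h j => h (π (Pi.single j (1 : A)))
      map_add' := fun _ _ => rfl
      map_smul' := fun _ _ => rfl }
  let co : (Fin k → T) →ₗ[B] (↥N →ₗ[A] T) :=
    { toFun := fun t => ∑ j, (LinearMap.toSpanSingleton A T (t j)) ∘ₗ LinearMap.proj j ∘ₗ ι
      map_add' := fun s t => by
        ext x
        simp [LinearMap.sum_apply, Finset.sum_add_distrib]
      map_smul' := fun b t => by
        ext x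
        simp [LinearMap.sum_apply, Finset.smul_sum, smul_comm] }
  refine memAdd_of_retract (N := ModuleCat.of B (↥N →ₗ[A] T)) (T := ModuleCat.of B T) ev co
    fun h => LinearMap.ext fun x => ?_
  have hx : ι x = ∑ j, (ι x j : A) • (Pi.single j (1 : A) : Fin k → A) :=
    pi_eq_sum_univ' (R := A) (ι x)
  conv_rhs => rw [← hπ x, hx]
  simp [co, ev, LinearMap.sum_apply]

/-- The truncation of the complex `Hom_A(P_•, T)` at degree `n`. -/
def homTruncation (B : Type u) [Ring B] (T : Type u) [AddCommGroup T] [Module A T] [Module B T]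
    [SMulCommClass A B T] (P : ℕ → ModuleCat.{u} A) (d : ∀ i, ↥(P (i + 1)) →ₗ[A] ↥(P i))
    (n i : ℕ) : Submodule B (↥(P i) →ₗ[A] T) where
  carrier := {h | (i = n → h ∘ₗ d i = 0) ∧ (n < i → h = 0)}
  add_mem' {a b} ha hb := ⟨fun hi => by rw [LinearMap.add_comp, ha.1 hi, hb.1 hi, add_zero],
    fun hi => by rw [ha.2 hi, hb.2 hi, add_zero]⟩
  zero_mem' := ⟨fun _ => LinearMap.zero_comp _, fun _ => rfl⟩
  smul_mem' b a ha := ⟨fun hi => by rw [LinearMap.smul_comp, ha.1 hi, smul_zero],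
    fun hi => by rw [ha.2 hi, smul_zero]⟩

/-- If `T` has projective dimension at most `n` over `A`, a truncated resolution of `T` by finitely
generated projectives is turned by `Hom_A(-, T)` into an `add T`-coresolution of `B = End_A(T)`. -/
lemma hasFiniteAddCoresolution_of_pdLE [SMulCommClass B A T]
    (hT : MemGenStar A (ModuleCat.of A A) (ModuleCat.of A T))
    (hB : Function.Bijective (Module.toModuleEnd A T : B →+* Module.End A T))
    (hExt : ∀ i, 0 < i → ExtVanish A i (ModuleCat.of A T) (ModuleCat.of A T))
    {n : ℕ} (hpd : PdLE A (ModuleCat.of A T) n) :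
    HasFiniteAddCoresolution B (ModuleCat.of B T) (ModuleCat.of B B) n := by
  obtain ⟨P, d, ε, hPadd, hε, h0, hd, -⟩ := hT
  have hP := fun i => (hPadd i).projective
  have hdd : ∀ i, d i ∘ₗ d (i + 1) = 0 := fun i => (hd i).linearMap_comp_eq_zero
  have hexact : ∀ i, HomExactAt P d i T := fun i =>
    (extVanish_succ_iff hP hε h0 hd i (ModuleCat.of A T)).1 (hExt _ i.succ_pos)
  obtain ⟨r, hr⟩ := (extVanish_succ_iff hP hε h0 hd n (ModuleCat.of A (LinearMap.range (d n)))).1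
    (hpd.extVanish _) (d n).rangeRestrict (LinearMap.ext fun x => Subtype.ext congr($(hdd n) x))
  let U := homTruncation B T P d n
  have hmaps : ∀ i, ∀ h ∈ U i, precomp (B := B) T (d i) h ∈ U (i + 1) := fun i h hh => by
    refine ⟨fun _ => ?_, fun hi => ?_⟩
    · change (h ∘ₗ d i) ∘ₗ d (i + 1) = 0
      rw [LinearMap.comp_assoc, hdd, LinearMap.comp_zero]
    · rcases (Nat.lt_succ_iff.1 hi).eq_or_lt with hi | hi
      · exact hh.1 hi.symm
      · rw [hh.2 hi, map_zero]
  have hunit : ∀ b : B, LinearMap.toSpanSingleton B (↥(P 0) →ₗ[A] T) ε b ∈ U 0 := fun b => by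
    refine ⟨fun _ => ?_, fun hi => absurd hi n.not_lt_zero⟩
    rw [LinearMap.toSpanSingleton_apply, LinearMap.smul_comp, h0.linearMap_comp_eq_zero,
      smul_zero]
  refine ⟨fun i => ModuleCat.of B (U i), fun i => (precomp T (d i)).restrict (hmaps i),
    (LinearMap.toSpanSingleton B (↥(P 0) →ₗ[A] T) ε).codRestrict (U 0) hunit,
    fun i hi => ?_, fun i hi => ?_, ?_, ?_, ?_⟩
  · rcases hi.eq_or_lt with rfl | hi
    · refine (hPadd i).hom.of_retract (N' := ModuleCat.of B (U i)) (U i).subtype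
        ((precomp T (LinearMap.id - (LinearMap.range (d i)).subtype ∘ₗ r)).codRestrict (U i)
          fun h => ⟨fun _ => ?_, fun hi => absurd hi (lt_irrefl _)⟩)
        fun h => Subtype.ext (LinearMap.ext fun x => ?_)
      · ext x
        have hx : (r (d i x) : ↥(P i)) = d i x := congr(Subtype.val ($hr x))
        simp [precomp, hx]
      · obtain ⟨y, hy⟩ := (r x).2
        have hy' : h.1 (r x : ↥(P i)) = 0 := by
          rw [← hy]
          exact congr($(h.2.1 rfl) y)
        change h.1 (x - (r x : ↥(P i))) = h.1 x
        rw [map_sub, hy', sub_zero]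
    · exact (hPadd i).hom.of_retract (N' := ModuleCat.of B (U i)) (U i).subtype
        (LinearMap.id.codRestrict (U i) fun h =>
          ⟨fun h => absurd h hi.ne, fun h => absurd h hi.not_gt⟩) fun h => rfl
  · exact ⟨fun a b => Subtype.ext ((a.2.2 hi).trans (b.2.2 hi).symm)⟩
  · intro b c hbc
    refine hB.1 (LinearMap.ext fun t => ?_)
    obtain ⟨x, rfl⟩ := hε t
    exact congr(($hbc).1 x)
  · rintro ⟨h, hh⟩
    constructor
    · intro hz
      obtain ⟨φ, hφ⟩ := exists_desc_of_exact hε h0 h congr(($hz).1)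
      obtain ⟨b, hb⟩ := hB.2 φ
      refine ⟨b, Subtype.ext (LinearMap.ext fun x => ?_)⟩
      exact congr($hb (ε x)).trans congr($hφ x)
    · rintro ⟨b, hb⟩
      obtain rfl : b • ε = h := congr(($hb).1)
      refine Subtype.ext ?_
      change (b • ε) ∘ₗ d 0 = 0
      rw [LinearMap.smul_comp, h0.linearMap_comp_eq_zero, smul_zero]
  · rintro i ⟨h, hh⟩
    constructor
    · intro hz
      rcases lt_or_ge i n with hi | hi
      · obtain ⟨k, hk⟩ := hexact i h congr(($hz).1)
        exact ⟨⟨k, fun h => absurd h hi.ne, fun h => absurd h hi.not_gt⟩, Subtype.ext hk⟩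
      · exact ⟨0, Subtype.ext (hh.2 (Nat.lt_succ_of_le hi)).symm⟩
    · rintro ⟨k, hk⟩
      obtain rfl : k.1 ∘ₗ d i = h := congr(($hk).1)
      refine Subtype.ext ?_
      change (k.1 ∘ₗ d i) ∘ₗ d (i + 1) = 0
      rw [LinearMap.comp_assoc, hdd, LinearMap.comp_zero]

end Coresolution

/-- Theorem 2.18. Let `T` be a Wakamatsu tilting `(S,R)`-bimodule with
`pd(T_R) = n < ∞`. If the generalized Auslander–Reiten conjecture holds for `S`, then `T`
is an `n`-tilting right `R`-module. -/
theorem garc_implies_tilting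
    (S R : Type u) [Ring S] [Ring R] (T : Type u) [AddCommGroup T] [Module S T]
    [Module Rᵐᵒᵖ T] [SMulCommClass S Rᵐᵒᵖ T]
    (hsd : IsSemidualizing S R T)
    (n : ℕ) (hpd : PdEq Rᵐᵒᵖ (ModuleCat.of Rᵐᵒᵖ T) n)
    (hGARC : ∀ (M : Type u) [AddCommGroup M] [Module S M], Module.Finite S M →
      ∀ m : ℕ, (∀ i, m < i → ExtVanish S i (ModuleCat.of S M) (ModuleCat.of S (M × S))) →
      PdLE S (ModuleCat.of S M) m) :
    IsNTilting Rᵐᵒᵖ (ModuleCat.of Rᵐᵒᵖ T) n := by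
  obtain ⟨hTR, hTS, hS, hR, hExtR, hExtS⟩ := hsd
  have := SMulCommClass.symm S Rᵐᵒᵖ T
  have hcores := hasFiniteAddCoresolution_of_pdLE hTR hS hExtR hpd.1
  refine ⟨hTR, hpd.1, hExtR, hasFiniteAddCoresolution_of_pdLE hTS hR hExtS ?_⟩
  obtain ⟨P, d, ε, hPadd, hε, h0, hd, -⟩ := hTS
  have hP := fun i => (hPadd i).projective
  have hexact : ∀ i, HomExactAt P d i T := fun i =>
    (extVanish_succ_iff hP hε h0 hd i (ModuleCat.of S T)).1 (hExtS _ i.succ_pos)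
  have := (hPadd 0).finite
  refine hGARC T (Module.Finite.of_surjective ε hε) n fun i hi => ?_
  obtain ⟨i, rfl⟩ : ∃ j, i = j + 1 := ⟨i - 1, by omega⟩
  exact (extVanish_succ_iff hP hε h0 hd i (ModuleCat.of S (T × S))).2
    ((hexact i).prod (hcores.homExactAt hP hd hexact (Nat.lt_succ_iff.1 hi)))
end

section
/- Let S and R be associative rings with identity and let T be an (S,R)-bimodule that is Wakamatsu tilting. If T is tensorly faithful, then the class X_T of left S-modules is closed under kernels of epimorphisms: for every short exact sequence 0 → M' → M → M'' → 0 of left S-modules with M and M'' in X_T, also M' belongs to X_T. -/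
/-!
Common definitions for formalizing the Wakamatsu tilting conjecture paper.
All rings are associative with identity; right `R`-modules are treated as
left `Rᵐᵒᵖ`-modules.
-/

open CategoryTheory

universe u

section ExtVanishing

variable {S : Type u} [Ring S] {T A B C : ModuleCat.{u} S}

/-- Vanishing of `Ext` read off a projective resolution of the first argument. -/
theorem extVanish_succ_iff_s3 (P : ProjectiveResolution T) (n : ℕ) :
    ExtVanish S (n + 1) T A ↔ ∀ φ : P.complex.X (n + 1) ⟶ A,
      P.complex.d (n + 2) (n + 1) ≫ φ = 0 →
      ∃ ψ : P.complex.X n ⟶ A, P.complex.d (n + 1) n ≫ ψ = φ := by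
  rw [ExtVanish, ← ModuleCat.isZero_iff_subsingleton, (P.isoExt (n + 1) A).isZero_iff,
    ← HomologicalComplex.exactAt_iff_isZero_homology,
    HomologicalComplex.exactAt_iff' _ n (n + 1) (n + 2) (by simp) (by simp),
    ShortComplex.moduleCat_exact_iff]
  rfl

theorem exists_augmentation (P : ProjectiveResolution T) :
    ∃ ε : P.complex.X 0 ⟶ T, Epi ε ∧ P.complex.d 1 0 ≫ ε = 0 ∧
      ∀ {Y : ModuleCat.{u} S} (f : P.complex.X 0 ⟶ Y), P.complex.d 1 0 ≫ f = 0 →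
        ∃ b : T ⟶ Y, ε ≫ b = f :=
  ⟨P.π.f 0, inferInstanceAs (Epi (P.π.f 0)), P.complex_d_comp_π_f_zero,
    fun f hf => P.exact₀.desc' f hf⟩

variable {i : A ⟶ B} {q : B ⟶ C} {w : i ≫ q = 0}

theorem exists_lift_of_extVanish_one (h : (ShortComplex.mk i q w).ShortExact)
    (hA : ExtVanish S 1 T A) (c : T ⟶ C) : ∃ b : T ⟶ B, b ≫ q = c := by
  have : Mono i := h.mono_f
  have : Epi q := h.epi_g
  let P := ProjectiveResolution.of T
  obtain ⟨ε, _, hε, hdesc⟩ := exists_augmentation P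
  obtain ⟨φ, hφ⟩ : ∃ φ : P.complex.X 0 ⟶ B, φ ≫ q = ε ≫ c :=
    ⟨Projective.factorThru _ q, Projective.factorThru_comp _ _⟩
  obtain ⟨χ, hχ⟩ : ∃ χ : P.complex.X 1 ⟶ A, χ ≫ i = P.complex.d 1 0 ≫ φ :=
    h.exact.lift' _ (by simp [hφ, reassoc_of% hε])
  obtain ⟨ψ, hψ⟩ := (extVanish_succ_iff_s3 P 0).1 hA χ (by
    rw [← cancel_mono i]; simp [hχ])
  obtain ⟨b, hb⟩ : ∃ b : T ⟶ B, ε ≫ b = φ - ψ ≫ i :=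
    hdesc (φ - ψ ≫ i) (by simp [← hχ, ← hψ])
  refine ⟨b, ?_⟩
  rw [← cancel_epi ε, ← Category.assoc, hb]
  simp [hφ, w]

theorem extVanish_one_of_exists_lift (h : (ShortComplex.mk i q w).ShortExact)
    (hB : ExtVanish S 1 T B) (hl : ∀ c : T ⟶ C, ∃ b : T ⟶ B, b ≫ q = c) :
    ExtVanish S 1 T A := by
  have : Mono i := h.mono_f
  let P := ProjectiveResolution.of T
  obtain ⟨ε, _, hε, hdesc⟩ := exists_augmentation P
  refine (extVanish_succ_iff_s3 P 0).2 fun φ hφ => ?_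
  obtain ⟨ψ, hψ⟩ := (extVanish_succ_iff_s3 P 0).1 hB (φ ≫ i) (by simp [reassoc_of% hφ])
  obtain ⟨c, hc⟩ : ∃ c : T ⟶ C, ε ≫ c = ψ ≫ q :=
    hdesc (ψ ≫ q) (by simp [reassoc_of% hψ, w])
  obtain ⟨b, rfl⟩ := hl c
  obtain ⟨χ, hχ⟩ : ∃ χ : P.complex.X 0 ⟶ A, χ ≫ i = ψ - ε ≫ b :=
    h.exact.lift' _ (by simp [← hc])
  refine ⟨χ, ?_⟩
  rw [← cancel_mono i, Category.assoc, hχ]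
  simp [hψ, reassoc_of% hε]

theorem extVanish_succ_succ_of_shortExact (h : (ShortComplex.mk i q w).ShortExact) {n : ℕ}
    (hB : ExtVanish S (n + 2) T B) (hC : ExtVanish S (n + 1) T C) :
    ExtVanish S (n + 2) T A := by
  have : Mono i := h.mono_f
  have : Epi q := h.epi_g
  let P := ProjectiveResolution.of T
  refine (extVanish_succ_iff_s3 P (n + 1)).2 fun φ hφ => ?_
  obtain ⟨ψ, hψ⟩ := (extVanish_succ_iff_s3 P (n + 1)).1 hB (φ ≫ i) (by simp [reassoc_of% hφ])
  obtain ⟨γ, hγ⟩ := (extVanish_succ_iff_s3 P n).1 hC (ψ ≫ q) (by simp [reassoc_of% hψ, w])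
  obtain ⟨β, rfl⟩ : ∃ β : P.complex.X n ⟶ B, β ≫ q = γ :=
    ⟨Projective.factorThru _ q, Projective.factorThru_comp _ _⟩
  obtain ⟨χ, hχ⟩ : ∃ χ : P.complex.X (n + 1) ⟶ A, χ ≫ i = ψ - P.complex.d _ _ ≫ β :=
    h.exact.lift' _ (by simp [hγ])
  refine ⟨χ, ?_⟩
  rw [← cancel_mono i, Category.assoc, hχ]
  simp [hψ]

/-- A finite direct sum decomposition in terms of structure maps. -/
theorem MemAdd.exists_sum_eq {X : ModuleCat.{u} S} (hX : MemAdd S T X) :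
    ∃ (k : ℕ) (i : Fin k → (T →ₗ[S] X)) (p : Fin k → (X →ₗ[S] T)),
      ∀ x, ∑ j, i j (p j x) = x := by
  obtain ⟨k, M, ⟨e⟩⟩ := hX
  refine ⟨k, fun j => LinearMap.fst S X M ∘ₗ e.symm.toLinearMap ∘ₗ
      LinearMap.single S (fun _ => (T : Type u)) j,
    fun j => LinearMap.proj j ∘ₗ e.toLinearMap ∘ₗ LinearMap.inl S X M, fun x => ?_⟩
  have hs : ∑ j, LinearMap.single S (fun _ : Fin k => (T : Type u)) j (e (x, 0) j) = e (x, 0) := by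
    ext l
    simp [Pi.single_apply]
  have := congrArg (fun v => (e.symm v).1) hs
  simpa [Prod.fst_sum] using this

theorem MemAdd.prod {X Y : ModuleCat.{u} S} (hX : MemAdd S T X) (hY : MemAdd S T Y) :
    MemAdd S T (ModuleCat.of S (X × Y)) := by
  obtain ⟨k, M, ⟨e⟩⟩ := hX
  obtain ⟨l, N, ⟨e'⟩⟩ := hY
  exact ⟨k + l, ModuleCat.of S (M × N), ⟨LinearEquiv.prodProdProdComm S X Y M N ≪≫ₗ
    e.prodCongr e' ≪≫ₗ (LinearEquiv.sumArrowLequivProdArrow _ _ S T).symm ≪≫ₗ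
    LinearEquiv.funCongrLeft S T finSumFinEquiv.symm⟩⟩

theorem MemAdd.of_subsingleton {X : ModuleCat.{u} S} [Subsingleton X] : MemAdd S T X :=
  ⟨0, X, ⟨LinearEquiv.ofSubsingleton _ _⟩⟩

theorem MemAdd.extVanish_succ {X : ModuleCat.{u} S} (hX : MemAdd S T X) {n : ℕ}
    (hT : ExtVanish S (n + 1) A T) : ExtVanish S (n + 1) A X := by
  let P := ProjectiveResolution.of A
  obtain ⟨k, i, p, hip⟩ := hX.exists_sum_eq
  have hid : ∑ j, ModuleCat.ofHom (p j) ≫ ModuleCat.ofHom (i j) = 𝟙 X := by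
    ext x
    simpa using hip x
  refine (extVanish_succ_iff_s3 P n).2 fun φ hφ => ?_
  choose ψ hψ using fun j => (extVanish_succ_iff_s3 P n).1 hT (φ ≫ ModuleCat.ofHom (p j))
    (by simp [reassoc_of% hφ])
  refine ⟨∑ j, ψ j ≫ ModuleCat.ofHom (i j), ?_⟩
  rw [Preadditive.comp_sum]
  simp only [reassoc_of% hψ]
  rw [← Preadditive.comp_sum, hid, Category.comp_id]

theorem shortExact_of_linearMap {A B C : Type u} [AddCommGroup A] [Module S A] [AddCommGroup B]
    [Module S B] [AddCommGroup C] [Module S C] {i : A →ₗ[S] B} {q : B →ₗ[S] C}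
    (hi : Function.Injective i) (hq : Function.Surjective q) (hiq : Function.Exact i q) :
    (ShortComplex.mk (ModuleCat.ofHom i) (ModuleCat.ofHom q)
      (by ext x; exact hiq.apply_apply_eq_zero x)).ShortExact :=
  ModuleCat.shortComplex_shortExact _ hiq hi hq

end ExtVanishing

section GenStar

variable {S : Type u} [Ring S] {T : ModuleCat.{u} S}

theorem shortExact_ker {X N : Type u} [AddCommGroup X] [Module S X] [AddCommGroup N] [Module S N]
    {q : X →ₗ[S] N} (hq : Function.Surjective q) :
    (ShortComplex.mk (ModuleCat.ofHom (LinearMap.ker q).subtype) (ModuleCat.ofHom q)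
      (by ext x; exact x.2)).ShortExact :=
  shortExact_of_linearMap (Submodule.injective_subtype _) hq (LinearMap.exact_subtype_ker_map q)

theorem exists_lift_of_extVanish_ker {X N : Type u} [AddCommGroup X] [Module S X]
    [AddCommGroup N] [Module S N] {q : X →ₗ[S] N} (hq : Function.Surjective q)
    (hE : ExtVanish S 1 T (ModuleCat.of S (LinearMap.ker q))) (h : T →ₗ[S] N) :
    ∃ h' : T →ₗ[S] X, q ∘ₗ h' = h := by
  obtain ⟨b, hb⟩ := exists_lift_of_extVanish_one (shortExact_ker hq) hE (ModuleCat.ofHom h)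
  exact ⟨b.hom, congrArg ModuleCat.Hom.hom hb⟩

theorem extVanish_ker_of_exists_lift {X N : Type u} [AddCommGroup X] [Module S X]
    [AddCommGroup N] [Module S N] {q : X →ₗ[S] N} (hq : Function.Surjective q)
    (hX : ExtVanish S 1 T (ModuleCat.of S X))
    (hl : ∀ h : T →ₗ[S] N, ∃ h' : T →ₗ[S] X, q ∘ₗ h' = h) :
    ExtVanish S 1 T (ModuleCat.of S (LinearMap.ker q)) := by
  refine extVanish_one_of_exists_lift (shortExact_ker hq) hX fun c => ?_
  obtain ⟨h', hh'⟩ := hl c.hom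
  exact ⟨ModuleCat.ofHom h', ModuleCat.hom_ext hh'⟩

/-- `N` has an `add_S T`-cover whose kernel is right orthogonal to `T` and lies in `𝒞`. -/
def HasAddCover (T : ModuleCat.{u} S) (𝒞 : ModuleCat.{u} S → Prop) (N : ModuleCat.{u} S) : Prop :=
  ∃ (X : ModuleCat.{u} S) (q : X →ₗ[S] N), MemAdd S T X ∧ Function.Surjective q ∧
    ExtVanish S 1 T (ModuleCat.of S (LinearMap.ker q)) ∧ 𝒞 (ModuleCat.of S (LinearMap.ker q))

theorem MemGenStar.hasAddCover {N : ModuleCat.{u} S} (hN : MemGenStar S T N) :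
    HasAddCover T (MemGenStar S T) N := by
  obtain ⟨X, f, f₀, hX, hf₀, h₀, h, hE₀, hE⟩ := hN
  refine ⟨X 0, f₀, hX 0, hf₀, hE₀, fun i => X (i + 1), fun i => f (i + 1),
    (f 0).codRestrict (LinearMap.ker f₀) h₀.apply_apply_eq_zero, fun i => hX _, ?_, ?_,
    fun i => h (i + 1), ?_, fun i => hE (i + 1)⟩
  · rintro ⟨x, hx⟩
    obtain ⟨y, rfl⟩ := (h₀ x).1 hx
    exact ⟨y, rfl⟩
  · intro y
    rw [← h 0 y]
    exact Subtype.ext_iff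
  · have hker := LinearMap.ker_codRestrict (LinearMap.ker f₀) (f 0) h₀.apply_apply_eq_zero
    exact hker ▸ hE 0

theorem exact_subtype_ker_comp {X Y N : Type u} [AddCommGroup X] [Module S X] [AddCommGroup Y]
    [Module S Y] [AddCommGroup N] [Module S N] {q : X →ₗ[S] N} {r : Y →ₗ[S] LinearMap.ker q}
    (hr : Function.Surjective r) : Function.Exact ((LinearMap.ker q).subtype ∘ₗ r) q := by
  rw [LinearMap.exact_iff, LinearMap.range_comp_of_range_eq_top _ (LinearMap.range_eq_top.2 hr),
    Submodule.range_subtype]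

/-- Coinduction principle for `gen*_S(T)`. -/
theorem MemGenStar.of_hasAddCover {𝒞 : ModuleCat.{u} S → Prop}
    (h𝒞 : ∀ N, 𝒞 N → HasAddCover T 𝒞 N) {N : ModuleCat.{u} S} (hN : 𝒞 N) :
    MemGenStar S T N := by
  choose X q hX hq hE hK using h𝒞
  let K : ℕ → {N : ModuleCat.{u} S // 𝒞 N} := fun n =>
    Nat.rec ⟨N, hN⟩ (fun _ A => ⟨ModuleCat.of S (LinearMap.ker (q A.1 A.2)), hK A.1 A.2⟩) n
  refine ⟨fun i => X (K i).1 (K i).2,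
    fun i => (LinearMap.ker (q (K i).1 (K i).2)).subtype ∘ₗ q (K (i + 1)).1 (K (i + 1)).2,
    q N hN, fun i => hX _ _, hq _ _, exact_subtype_ker_comp (hq _ _), fun i => ?_, hE _ _,
    fun i => ?_⟩
  · exact (exact_subtype_ker_comp (hq (K (i + 2)).1 (K (i + 2)).2)).comp_injective _
      (Submodule.injective_subtype _) (map_zero _)
  · have hker := LinearMap.ker_comp_of_ker_eq_bot (q (K (i + 1)).1 (K (i + 1)).2)
      (Submodule.ker_subtype (LinearMap.ker (q (K i).1 (K i).2)))
    exact hker ▸ hE _ _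

theorem HasAddCover.memGenStar {N : ModuleCat.{u} S} (hN : HasAddCover T (MemGenStar S T) N) :
    MemGenStar S T N := by
  refine MemGenStar.of_hasAddCover (𝒞 := HasAddCover T (MemGenStar S T)) ?_ hN
  rintro N ⟨X, q, hX, hq, hE, hK⟩
  exact ⟨X, q, hX, hq, hE, hK.hasAddCover⟩

theorem MemAdd.memGenStar (hT : ExtVanish S 1 T T) {X : ModuleCat.{u} S} (hX : MemAdd S T X) :
    MemGenStar S T X := by
  refine MemGenStar.of_hasAddCover (𝒞 := MemAdd S T) (fun N hN => ?_) hX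
  have : Subsingleton (LinearMap.ker (LinearMap.id : N →ₗ[S] N)) := by
    rw [LinearMap.ker_id]; infer_instance
  exact ⟨N, LinearMap.id, hN, Function.surjective_id,
    extVanish_ker_of_exists_lift Function.surjective_id (hN.extVanish_succ hT)
      fun h => ⟨h, rfl⟩, MemAdd.of_subsingleton⟩

/-- `B` is an extension of two members of `gen*_S(T)` on which `Hom_S(T, -)` is exact. -/
def IsGenStarExtension (T B : ModuleCat.{u} S) : Prop :=
  ∃ (A C : ModuleCat.{u} S) (i : A →ₗ[S] B) (p : B →ₗ[S] C), MemGenStar S T A ∧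
    MemGenStar S T C ∧ Function.Injective i ∧ Function.Surjective p ∧ Function.Exact i p ∧
    ∀ h : T →ₗ[S] C, ∃ h' : T →ₗ[S] B, p ∘ₗ h' = h

theorem MemAdd.exists_lift {X : ModuleCat.{u} S} (hX : MemAdd S T X) {B C : Type u}
    [AddCommGroup B] [Module S B] [AddCommGroup C] [Module S C] {p : B →ₗ[S] C}
    (hl : ∀ h : T →ₗ[S] C, ∃ h' : T →ₗ[S] B, p ∘ₗ h' = h) (h : X →ₗ[S] C) :
    ∃ h' : X →ₗ[S] B, p ∘ₗ h' = h := by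
  obtain ⟨k, i, r, hir⟩ := hX.exists_sum_eq
  choose l hl using fun j => hl (h ∘ₗ i j)
  refine ⟨∑ j, l j ∘ₗ r j, LinearMap.ext fun x => ?_⟩
  have hx (j) : p (l j (r j x)) = h (i j (r j x)) := LinearMap.congr_fun (hl j) _
  simp only [LinearMap.comp_apply, LinearMap.sum_apply, map_sum, hx]
  rw [← map_sum, hir]

theorem exists_factor_of_exact {A B C N : Type u} [AddCommGroup A] [Module S A]
    [AddCommGroup B] [Module S B] [AddCommGroup C] [Module S C] [AddCommGroup N] [Module S N]
    {i : A →ₗ[S] B} {p : B →ₗ[S] C} (hi : Function.Injective i) (hip : Function.Exact i p)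
    (h : N →ₗ[S] B) (hh : ∀ x, p (h x) = 0) : ∃ h' : N →ₗ[S] A, i ∘ₗ h' = h := by
  refine ⟨(LinearEquiv.ofInjective i hi).symm.toLinearMap ∘ₗ
    h.codRestrict (LinearMap.range i) fun x => (hip _).1 (hh x), LinearMap.ext fun x => ?_⟩
  exact congrArg Subtype.val ((LinearEquiv.ofInjective i hi).apply_symm_apply _)

/-- Horseshoe lemma for `gen*_S(T)`. -/
theorem IsGenStarExtension.hasAddCover (hT : ExtVanish S 1 T T) {B : ModuleCat.{u} S}
    (hB : IsGenStarExtension T B) : HasAddCover T (IsGenStarExtension T) B := by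
  obtain ⟨A, C, i, p, hA, hC, hi, hp, hip, hl⟩ := hB
  obtain ⟨X, q, hX, hq, hqE, hqK⟩ := hA.hasAddCover
  obtain ⟨Y, r, hY, hr, hrE, hrK⟩ := hC.hasAddCover
  obtain ⟨s, hs⟩ := hY.exists_lift hl r
  have hs' (y : Y) : p (s y) = r y := LinearMap.congr_fun hs y
  have hpi := hip.apply_apply_eq_zero
  let t : X × Y →ₗ[S] B := (i ∘ₗ q).coprod s
  have ht (x : X) (y : Y) : t (x, y) = i (q x) + s y := rfl
  have hts : Function.Surjective t := fun b => by
    obtain ⟨y, hy⟩ := hr (p b)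
    obtain ⟨a, ha⟩ := (hip (b - s y)).1 (by simp [hs', hy])
    obtain ⟨x, rfl⟩ := hq a
    exact ⟨(x, y), by simp [ht, ha]⟩
  have htY (z : X × Y) (hz : z ∈ LinearMap.ker t) : z.2 ∈ LinearMap.ker r := by
    have := congrArg p (show i (q z.1) + s z.2 = 0 from hz)
    simpa [hpi, hs'] using this
  have hlift (h : T →ₗ[S] B) (y : T →ₗ[S] Y) (hy : ∀ a, r (y a) = p (h a)) :
      ∃ x : T →ₗ[S] X, ∀ a, t (x a, y a) = h a := by
    obtain ⟨α, hα⟩ := exists_factor_of_exact hi hip (h - s ∘ₗ y) (by simp [hs', hy])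
    obtain ⟨x, rfl⟩ := exists_lift_of_extVanish_ker hq hqE α
    refine ⟨x, fun a => ?_⟩
    have : i (q (x a)) = h a - s (y a) := LinearMap.congr_fun hα a
    simp [ht, this]
  refine ⟨ModuleCat.of S (X × Y), t, hX.prod hY, hts, ?_, ModuleCat.of S (LinearMap.ker q),
    ModuleCat.of S (LinearMap.ker r),
    (LinearMap.inl S X Y ∘ₗ (LinearMap.ker q).subtype).codRestrict (LinearMap.ker t) ?_,
    (LinearMap.snd S X Y).restrict htY, hqK, hrK, ?_, ?_, ?_, ?_⟩
  · refine extVanish_ker_of_exists_lift hts ((hX.prod hY).extVanish_succ hT) fun h => ?_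
    obtain ⟨y, hy⟩ := exists_lift_of_extVanish_ker hr hrE (p ∘ₗ h)
    obtain ⟨x, hx⟩ := hlift h y (LinearMap.congr_fun hy)
    exact ⟨x.prod y, LinearMap.ext hx⟩
  · rintro ⟨x, hx⟩
    have : q x = 0 := hx
    simp [ht, this]
  · intro x x' h
    exact Subtype.ext (congrArg (fun z => z.1.1) h)
  · rintro ⟨y, hy⟩
    obtain ⟨a, ha⟩ := (hip (s y)).1 (by rw [hs']; exact hy)
    obtain ⟨x, hx⟩ := hq (-a)
    exact ⟨⟨(x, y), by simp [ht, hx, ha]⟩, rfl⟩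
  · rintro ⟨⟨x, y⟩, hxy⟩
    have hxy' : i (q x) + s y = 0 := hxy
    constructor
    · intro h
      obtain rfl : y = 0 := congrArg Subtype.val h
      have hx : q x = 0 := hi (by simpa using hxy')
      exact ⟨⟨x, hx⟩, rfl⟩
    · rintro ⟨x', hx'⟩
      exact Subtype.ext (congrArg (fun z => z.1.2) hx').symm
  · intro h
    obtain ⟨x, hx⟩ := hlift 0 ((LinearMap.ker r).subtype ∘ₗ h) (by simp)
    exact ⟨(x.prod ((LinearMap.ker r).subtype ∘ₗ h)).codRestrict (LinearMap.ker t) hx, rfl⟩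

theorem IsGenStarExtension.memGenStar (hT : ExtVanish S 1 T T) {B : ModuleCat.{u} S}
    (hB : IsGenStarExtension T B) : MemGenStar S T B :=
  MemGenStar.of_hasAddCover (fun _ h => h.hasAddCover hT) hB

end GenStar

section KernelsOfEpis

variable {S : Type u} [Ring S]

/-- `gen*_S(T)` is closed under kernels of `Hom_S(T, -)`-exact epimorphisms. -/
theorem MemGenStar.of_exact {T M' M M'' : ModuleCat.{u} S} (hT : ExtVanish S 1 T T)
    (hM : MemGenStar S T M) (hM'' : MemGenStar S T M'') {f : M' →ₗ[S] M} {g : M →ₗ[S] M''}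
    (hf : Function.Injective f) (hfg : Function.Exact f g)
    (hl : ∀ h : T →ₗ[S] M'', ∃ h' : T →ₗ[S] M, g ∘ₗ h' = h) : MemGenStar S T M' := by
  obtain ⟨Y, r, hY, hr, hrE, hrK⟩ := hM''.hasAddCover
  obtain ⟨s, hs⟩ := hY.exists_lift hl r
  have hs' (y : Y) : g (s y) = r y := LinearMap.congr_fun hs y
  have hgf := hfg.apply_apply_eq_zero
  obtain ⟨c, hc⟩ := exists_factor_of_exact hf hfg (-(s ∘ₗ (LinearMap.ker r).subtype))
    (by rintro ⟨y, hy⟩; simpa [hs'] using hy)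
  have hc' (y : LinearMap.ker r) : f (c y) = -s y := LinearMap.congr_fun hc y
  have hB : MemGenStar S T (ModuleCat.of S (M' × Y)) := by
    refine IsGenStarExtension.memGenStar hT ⟨ModuleCat.of S (LinearMap.ker r), M,
      c.prod (LinearMap.ker r).subtype, f.coprod s, hrK, hM, ?_, ?_, ?_, ?_⟩
    · intro y y' h
      exact Subtype.ext (congrArg Prod.snd h)
    · intro m
      obtain ⟨y, hy⟩ := hr (g m)
      obtain ⟨m', hm'⟩ := (hfg (m - s y)).1 (by simp [hs', hy])
      exact ⟨(m', y), by simp [hm']⟩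
    · rintro ⟨m', y⟩
      constructor
      · intro h
        have h' : f m' + s y = 0 := h
        have hy : r y = 0 := by simpa [hgf, hs'] using congrArg g h'
        refine ⟨⟨y, hy⟩, Prod.ext (hf ?_) rfl⟩
        exact (hc' _).trans (eq_neg_of_add_eq_zero_left h').symm
      · rintro ⟨y', hy'⟩
        rw [← hy']
        change f (c y') + s y' = 0
        rw [hc', neg_add_cancel]
    · intro h
      obtain ⟨y, hy⟩ := exists_lift_of_extVanish_ker hr hrE (g ∘ₗ h)
      have hy' (a : T) : r (y a) = g (h a) := LinearMap.congr_fun hy a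
      obtain ⟨m', hm'⟩ := exists_factor_of_exact hf hfg (h - s ∘ₗ y) (by simp [hs', hy'])
      refine ⟨m'.prod y, LinearMap.ext fun a => ?_⟩
      have : f (m' a) = h a - s (y a) := LinearMap.congr_fun hm' a
      change f (m' a) + s (y a) = h a
      rw [this, sub_add_cancel]
  obtain ⟨X, t, hX, ht, htE, htK⟩ := hB.hasAddCover
  let π₁ : M' × Y →ₗ[S] M' := LinearMap.fst S M' Y
  let π₂ : M' × Y →ₗ[S] Y := LinearMap.snd S M' Y
  have hu : Function.Surjective (π₁ ∘ₗ t) := Prod.fst_surjective.comp ht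
  have hle : LinearMap.ker t ≤ LinearMap.ker (π₁ ∘ₗ t) := LinearMap.ker_le_ker_comp _ _
  refine HasAddCover.memGenStar ⟨X, π₁ ∘ₗ t, hX, hu, ?_, ?_⟩
  · refine extVanish_ker_of_exists_lift hu (hX.extVanish_succ hT) fun h => ?_
    obtain ⟨h', hh'⟩ := exists_lift_of_extVanish_ker ht htE (h.prod 0)
    exact ⟨h', LinearMap.ext fun a => congrArg Prod.fst (LinearMap.congr_fun hh' a)⟩
  · refine IsGenStarExtension.memGenStar hT ⟨ModuleCat.of S (LinearMap.ker t), Y,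
      Submodule.inclusion hle, π₂ ∘ₗ t ∘ₗ (LinearMap.ker (π₁ ∘ₗ t)).subtype, htK,
      hY.memGenStar hT, Submodule.inclusion_injective hle, ?_, ?_, ?_⟩
    · intro y
      obtain ⟨x, hx⟩ := ht (0, y)
      exact ⟨⟨x, congrArg Prod.fst hx⟩, congrArg Prod.snd hx⟩
    · rintro ⟨x, hx⟩
      constructor
      · intro h
        exact ⟨⟨x, Prod.ext hx h⟩, rfl⟩
      · rintro ⟨⟨x', hx'⟩, h⟩
        obtain rfl : x' = x := congrArg Subtype.val h
        exact congrArg Prod.snd hx'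
    · intro h
      obtain ⟨h', hh'⟩ := exists_lift_of_extVanish_ker ht htE ((0 : T →ₗ[S] M').prod h)
      exact ⟨h'.codRestrict (LinearMap.ker (π₁ ∘ₗ t))
        fun a => congrArg Prod.fst (LinearMap.congr_fun hh' a),
        LinearMap.ext fun a => congrArg Prod.snd (LinearMap.congr_fun hh' a)⟩

/-- A module in `gen*_S(T)` is generated by the images of the maps out of `T`. -/
theorem MemGenStar.mem_of_forall_apply_mem {T N : ModuleCat.{u} S} (hN : MemGenStar S T N)
    (W : AddSubgroup N) (hW : ∀ (h : T →ₗ[S] N) (t : T), h t ∈ W) (x : N) : x ∈ W := by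
  obtain ⟨X, q, hX, hq, -, -⟩ := hN.hasAddCover
  obtain ⟨k, i, p, hip⟩ := hX.exists_sum_eq
  obtain ⟨y, rfl⟩ := hq x
  rw [← hip y, map_sum]
  exact sum_mem fun j _ => hW (q ∘ₗ i j) _

variable {R : Type u} [Ring R] {T : Type u} [AddCommGroup T] [Module S T] [Module Rᵐᵒᵖ T]
  [SMulCommClass S Rᵐᵒᵖ T]

/-- If `T` is tensorly faithful, then `Hom_S(T, -)` is exact on epimorphisms between modules in
`gen*_S(T)`. -/
theorem exists_lift_of_tensorlyFaithful (hR : Function.Surjective (rightEndNat S R T))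
    (hfaith : TensorlyFaithful R T) {M M'' : Type u} [AddCommGroup M] [Module S M]
    [AddCommGroup M''] [Module S M'']
    (hM : MemGenStar S (ModuleCat.of S T) (ModuleCat.of S M))
    (hM'' : MemGenStar S (ModuleCat.of S T) (ModuleCat.of S M''))
    {g : M →ₗ[S] M''} (hg : Function.Surjective g) (h : T →ₗ[S] M'') :
    ∃ h' : T →ₗ[S] M, g ∘ₗ h' = h := by
  let := homModule S R T M''
  have hsmul (r : R) (h : T →ₗ[S] M'') (t : T) : (r • h) t = h (MulOpposite.op r • t) := rfl
  let N : Submodule R (T →ₗ[S] M'') :=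
    { carrier := {h | ∃ h' : T →ₗ[S] M, g ∘ₗ h' = h}
      add_mem' := by
        rintro _ _ ⟨a, rfl⟩ ⟨b, rfl⟩
        exact ⟨a + b, LinearMap.comp_add _ _ _⟩
      zero_mem' := ⟨0, LinearMap.comp_zero _⟩
      smul_mem' := by
        rintro r _ ⟨a, rfl⟩
        let := homModule S R T M
        exact ⟨r • a, rfl⟩ }
  change h ∈ N
  by_contra hN
  have hnt : Nontrivial ((T →ₗ[S] M'') ⧸ N) :=
    Submodule.Quotient.nontrivial_iff.2 fun h' => hN (h' ▸ Submodule.mem_top)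
  refine hfaith _ hnt ?_
  obtain ⟨X, q, hX, hq, hE, hK⟩ := hM''.hasAddCover
  obtain ⟨k, i, p, hip⟩ := hX.exists_sum_eq
  let s : X →+ TensorProduct ℤ T ((T →ₗ[S] M'') ⧸ N) :=
    ∑ j, ((TensorProduct.mk ℤ T _).flip (N.mkQ (q ∘ₗ i j))).toAddMonoidHom.comp
      (p j).toAddMonoidHom
  have hs (y : X) : s y = ∑ j, p j y ⊗ₜ[ℤ] N.mkQ (q ∘ₗ i j) := by
    simp [s]
  have hst (a : T →ₗ[S] X) (t : T) :
      s (a t) - t ⊗ₜ[ℤ] N.mkQ (q ∘ₗ a) ∈ TensorRel R T ((T →ₗ[S] M'') ⧸ N) := by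
    choose r hr using fun j => hR (p j ∘ₗ a)
    have hr' (j) (t : T) : p j (a t) = r j • t := (LinearMap.congr_fun (hr j) t).symm
    have hqa : q ∘ₗ a = ∑ j, (r j).unop • (q ∘ₗ i j) := by
      ext t
      rw [LinearMap.sum_apply]
      simp only [hsmul, MulOpposite.op_unop, ← hr', LinearMap.comp_apply]
      rw [← map_sum, hip]
    rw [hs, hqa, map_sum, TensorProduct.tmul_sum, ← Finset.sum_sub_distrib]
    refine sum_mem fun j _ => AddSubgroup.subset_closure
      ⟨t, (r j).unop, N.mkQ (q ∘ₗ i j), ?_⟩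
    rw [hr', map_smul, MulOpposite.op_unop]
  let W : AddSubgroup X := (TensorRel R T ((T →ₗ[S] M'') ⧸ N)).comap s
  have hW (a : T →ₗ[S] X) (ha : q ∘ₗ a ∈ N) (t : T) : a t ∈ W := by
    have h0 : N.mkQ (q ∘ₗ a) = 0 := (Submodule.Quotient.mk_eq_zero N).2 ha
    have := hst a t
    rwa [h0, TensorProduct.tmul_zero, sub_zero] at this
  have hker (y : LinearMap.ker q) : (y : X) ∈ W := by
    refine hK.mem_of_forall_apply_mem
      (W.comap (LinearMap.ker q).subtype.toAddMonoidHom) (fun b t => ?_) y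
    refine hW ((LinearMap.ker q).subtype ∘ₗ b) ?_ t
    have : q ∘ₗ (LinearMap.ker q).subtype ∘ₗ b = 0 := LinearMap.ext fun x => (b x).2
    rw [this]
    exact N.zero_mem
  have htop (y : X) : y ∈ W := by
    obtain ⟨m, hm⟩ := hg (q y)
    obtain ⟨w, hw, hwm⟩ := hM.mem_of_forall_apply_mem
      ((W.map q.toAddMonoidHom).comap g.toAddMonoidHom) (fun b t => by
        obtain ⟨a, ha⟩ := exists_lift_of_extVanish_ker hq hE (g ∘ₗ b)
        exact ⟨a t, hW a ⟨b, ha.symm⟩ t, LinearMap.congr_fun ha t⟩) m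
    have hwy : q w = q y := hwm.trans hm
    have := W.add_mem (hker ⟨y - w, by simp [hwy]⟩) hw
    simpa using this
  refine eq_top_iff.2 fun x _ => ?_
  induction x with
  | zero => exact zero_mem _
  | add x y hx hy => exact add_mem (hx trivial) (hy trivial)
  | tmul t c =>
    obtain ⟨b, rfl⟩ := N.mkQ_surjective c
    obtain ⟨a, rfl⟩ := exists_lift_of_extVanish_ker hq hE b
    have hsa : s (a t) ∈ TensorRel R T ((T →ₗ[S] M'') ⧸ N) := htop (a t)
    simpa using sub_mem hsa (hst a t)

end KernelsOfEpis

/-- Lemma 2.8. Let `T` be a Wakamatsu tilting (semidualizing)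
`(S,R)`-bimodule which is tensorly faithful. Then the class `X_T` of left `S`-modules is
closed under kernels of epimorphisms. -/
theorem xT_closed_under_kernels_of_epis
    (S R : Type u) [Ring S] [Ring R] (T : Type u) [AddCommGroup T] [Module S T]
    [Module Rᵐᵒᵖ T] [SMulCommClass S Rᵐᵒᵖ T]
    (hsd : IsSemidualizing S R T) (hfaith : TensorlyFaithful R T)
    (M' M M'' : Type u) [AddCommGroup M'] [Module S M'] [AddCommGroup M] [Module S M]
    [AddCommGroup M''] [Module S M'']
    (f : M' →ₗ[S] M) (g : M →ₗ[S] M'')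
    (hf : Function.Injective f) (hg : Function.Surjective g) (hfg : Function.Exact f g)
    (hM : MemXT S (ModuleCat.of S T) (ModuleCat.of S M))
    (hM'' : MemXT S (ModuleCat.of S T) (ModuleCat.of S M'')) :
    MemXT S (ModuleCat.of S T) (ModuleCat.of S M') := by
  obtain ⟨-, -, -, hR, -, hExt⟩ := hsd
  obtain ⟨hMp, hMg⟩ := hM
  obtain ⟨hMp'', hMg''⟩ := hM''
  have hl := exists_lift_of_tensorlyFaithful hR.2 hfaith hMg hMg'' hg
  have hSE := shortExact_of_linearMap hf hg hfg
  refine ⟨fun n hn => ?_, MemGenStar.of_exact (hExt 1 one_pos) hMg hMg'' hf hfg hl⟩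
  obtain ⟨n, rfl⟩ := Nat.exists_eq_add_of_le' hn
  cases n with
  | zero =>
    refine extVanish_one_of_exists_lift hSE (hMp 1 le_rfl) fun c => ?_
    obtain ⟨b, hb⟩ := hl c.hom
    exact ⟨ModuleCat.ofHom b, ModuleCat.hom_ext hb⟩
  | succ n =>
    exact extVanish_succ_succ_of_shortExact hSE (hMp _ hn) (hMp'' _ n.succ_pos)
end
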